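/- arXiv:2604.08504 — 8 statements merged into one kernel-verified Lean document; each statement's English description precedes it below -/
import Mathlib

section
/- Let 𝓛 = {L_1, …, L_k} be a finite collection of infinite subsets of ℕ with closure dimension d, and let ε > 0 and n ∈ ℕ. Then there exists an ε-differentially private algorithm A : (Fin n → ℕ) → PMF(ℕ) such that for every i ∈ {1,…,k} and every injective input x : Fin n → ℕ whose range is contained in L_i, the probability that A(x) outputs an element of L_i \ range(x) is at least 1 − 5·exp(−ε(n−d)/(2k)). -/
/-- Two finite inputs are neighboring if they differ in exactly one coordinate. -/
def NeighboringFin {n : ℕ} {α : Type*} (x x' : Fin n → α) : Prop :=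
  ∃ j, x j ≠ x' j ∧ ∀ m, m ≠ j → x m = x' m

/-- ε-differential privacy for an algorithm on `n` input strings. -/
def DPFin {n : ℕ} {α Y : Type*} (ε : ℝ) (A : (Fin n → α) → PMF Y) : Prop :=
  ∀ x x' : Fin n → α, NeighboringFin x x' → ∀ E : Set Y,
    (A x).toOuterMeasure E ≤ ENNReal.ofReal (Real.exp ε) * (A x').toOuterMeasure E

/-- The closure of a subcollection: the intersection of its languages
(with `Cl L ∅ = Set.univ`). -/
def Cl {k : ℕ} (L : Fin k → Set ℕ) (S : Finset (Fin k)) : Set ℕ := ⋂ i ∈ S, L i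

/-- `d` bounds the closure dimension: every subcollection has closure that is
either infinite or of cardinality at most `d`. -/
def IsClosureBound {k : ℕ} (L : Fin k → Set ℕ) (d : ℤ) : Prop :=
  ∀ S : Finset (Fin k), (Cl L S).Infinite ∨ ((Cl L S).ncard : ℤ) ≤ d

/-- The closure dimension of the collection `L` is the smallest
`d ∈ {-1} ∪ ℕ` that bounds it. -/
def HasClosureDim {k : ℕ} (L : Fin k → Set ℕ) (d : ℤ) : Prop :=
  IsClosureBound L d ∧ ∀ d' : ℤ, -1 ≤ d' → IsClosureBound L d' → d ≤ d'

open Classical in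
/-- The number of coordinates of `x` that lie in `C`. -/
noncomputable def hitCount {n : ℕ} (C : Set ℕ) (x : Fin n → ℕ) : ℕ :=
  (Finset.univ.filter fun j => x j ∈ C).card

theorem hitCount_le_add_one {n : ℕ} (C : Set ℕ) {x x' : Fin n → ℕ} (h : NeighboringFin x x') :
    hitCount C x ≤ hitCount C x' + 1 := by
  classical
  obtain ⟨j, -, hj⟩ := h
  refine (Finset.card_le_card ?_).trans (Finset.card_insert_le j _)
  intro m hm
  by_cases hmj : m = j
  · simp [hmj]
  · simp only [Finset.mem_filter, Finset.mem_univ, true_and, Finset.mem_insert] at hm ⊢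
    exact Or.inr (hj m hmj ▸ hm)

theorem hitCount_le_ncard {n : ℕ} {C : Set ℕ} (hC : C.Finite) {x : Fin n → ℕ}
    (hx : Function.Injective x) : hitCount C x ≤ C.ncard := by
  classical
  rw [hitCount, ← Finset.card_image_of_injective _ hx, ← Set.ncard_coe_finset]
  refine Set.ncard_le_ncard ?_ hC
  intro y hy
  simp only [Finset.coe_image, Set.mem_image, Finset.mem_coe, Finset.mem_filter] at hy
  obtain ⟨m, ⟨-, hm⟩, rfl⟩ := hy
  exact hm

theorem hitCount_eq_of_range_subset {n : ℕ} {C : Set ℕ} {x : Fin n → ℕ}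
    (h : Set.range x ⊆ C) : hitCount C x = n := by
  classical
  rw [hitCount, Finset.filter_true_of_mem fun j _ => h ⟨j, rfl⟩, Finset.card_univ,
    Fintype.card_fin]

theorem Cl_insert {k : ℕ} (L : Fin k → Set ℕ) (i : Fin k) (S : Finset (Fin k)) :
    Cl L (insert i S) = L i ∩ Cl L S := by
  simp [Cl]

theorem Cl_subset {k : ℕ} (L : Fin k → Set ℕ) {i : Fin k} {S : Finset (Fin k)} (hi : i ∈ S) :
    Cl L S ⊆ L i := Set.biInter_subset_of_mem hi

theorem hitCount_Cl_insert {n k : ℕ} (L : Fin k → Set ℕ) {i : Fin k} (S : Finset (Fin k))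
    {x : Fin n → ℕ} (h : Set.range x ⊆ L i) :
    hitCount (Cl L (insert i S)) x = hitCount (Cl L S) x := by
  have hm : ∀ j, x j ∈ L i := fun j => h ⟨j, rfl⟩
  unfold hitCount
  congr 1
  ext j
  simp [Cl_insert, hm]

/-- An infinite set carries a distribution that avoids any given `n` points up to small
probability. -/
theorem exists_pmf_compl_diff_range_le {C : Set ℕ} (hC : C.Infinite) (n : ℕ) {δ : ℝ}
    (hδ : 0 < δ) :
    ∃ p : PMF ℕ, ∀ x : Fin n → ℕ,
      p.toOuterMeasure (C \ Set.range x)ᶜ ≤ ENNReal.ofReal δ := by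
  classical
  obtain ⟨N, hN⟩ := exists_nat_gt (n / δ)
  obtain ⟨s, hsC, hs⟩ := hC.exists_subset_card_eq (N + 1)
  have hne : s.Nonempty := Finset.card_pos.1 (by omega)
  refine ⟨PMF.uniformOfFinset s hne, fun x => ?_⟩
  rw [PMF.toOuterMeasure_uniformOfFinset_apply, hs]
  have hcard : (s.filter (· ∈ (C \ Set.range x)ᶜ)).card ≤ n := by
    calc _ ≤ (Finset.univ.image x).card := by
          refine Finset.card_le_card fun y hy => ?_
          simp only [Finset.mem_filter, Set.mem_compl_iff, Set.mem_sdiff, not_and, not_not] at hy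
          obtain ⟨m, hm⟩ := hy.2 (hsC hy.1)
          exact Finset.mem_image.2 ⟨m, Finset.mem_univ m, hm⟩
      _ ≤ n := Finset.card_image_le.trans (by simp)
  calc _ ≤ (n : ENNReal) / ((N + 1 : ℕ) : ENNReal) := by
        gcongr
        exact le_trans (le_of_eq (by congr)) hcard
    _ = ENNReal.ofReal ((n : ℝ) / ((N + 1 : ℕ) : ℝ)) := by
        rw [ENNReal.ofReal_div_of_pos (by positivity), ENNReal.ofReal_natCast,
          ENNReal.ofReal_natCast]
    _ ≤ ENNReal.ofReal δ := by
        refine ENNReal.ofReal_le_ofReal ?_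
        rw [div_le_iff₀ (by positivity)]
        rw [div_lt_iff₀ hδ] at hN
        push_cast
        nlinarith

/-- The distribution on a finite type proportional to a nonnegative real weight. -/
noncomputable def weightPMF {ι : Type*} [Fintype ι] (w : ι → ℝ) (hw : ∀ i, 0 ≤ w i)
    (hZ : 0 < ∑ i, w i) : PMF ι :=
  PMF.ofFintype (fun i => ENNReal.ofReal (w i / ∑ j, w j)) (by
    rw [← ENNReal.ofReal_sum_of_nonneg fun i _ => div_nonneg (hw i) hZ.le, ← Finset.sum_div,
      div_self hZ.ne', ENNReal.ofReal_one])

theorem weightPMF_le_of_le {ι : Type*} [Fintype ι] {w w' : ι → ℝ} (hw : ∀ i, 0 ≤ w i)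
    (hZ : 0 < ∑ i, w i) (hw' : ∀ i, 0 ≤ w' i) (hZ' : 0 < ∑ i, w' i) {ε : ℝ}
    (h : ∀ i, w i ≤ Real.exp (ε / 2) * w' i) (h' : ∀ i, w' i ≤ Real.exp (ε / 2) * w i) (i : ι) :
    weightPMF w hw hZ i ≤ ENNReal.ofReal (Real.exp ε) * weightPMF w' hw' hZ' i := by
  simp only [weightPMF, PMF.ofFintype_apply]
  rw [← ENNReal.ofReal_mul (Real.exp_nonneg _)]
  refine ENNReal.ofReal_le_ofReal ?_
  have hsum : ∑ i, w' i ≤ Real.exp (ε / 2) * ∑ i, w i := by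
    rw [Finset.mul_sum]; exact Finset.sum_le_sum fun i _ => h' i
  have hexp : Real.exp ε = Real.exp (ε / 2) * Real.exp (ε / 2) := by
    rw [← Real.exp_add]; ring_nf
  rw [mul_div_assoc', div_le_div_iff₀ hZ hZ', hexp]
  calc w i * ∑ i, w' i ≤ (Real.exp (ε / 2) * w' i) * (Real.exp (ε / 2) * ∑ i, w i) :=
        mul_le_mul (h i) hsum hZ'.le (mul_nonneg (Real.exp_nonneg _) (hw' i))
    _ = _ := by ring

/-- Postprocessing by a random map preserves pointwise privacy bounds. -/
theorem DPFin_bind {n : ℕ} {α ι Y : Type*} {ε : ℝ} {P : (Fin n → α) → PMF ι} (κ : ι → PMF Y)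
    (h : ∀ x x', NeighboringFin x x' → ∀ i, P x i ≤ ENNReal.ofReal (Real.exp ε) * P x' i) :
    DPFin ε fun x => (P x).bind κ := by
  intro x x' hx E
  rw [PMF.toOuterMeasure_bind_apply, PMF.toOuterMeasure_bind_apply, ← ENNReal.tsum_mul_left]
  refine ENNReal.tsum_le_tsum fun i => ?_
  rw [← mul_assoc]
  gcongr
  exact h x x' hx i

theorem DPFin_const {n : ℕ} {α Y : Type*} {ε : ℝ} (hε : 0 ≤ ε) (p : PMF Y) :
    DPFin ε fun _ : Fin n → α => p := by
  intro x x' _ E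
  refine le_mul_of_one_le_left (zero_le) ?_
  rw [← ENNReal.ofReal_one]
  exact ENNReal.ofReal_le_ofReal (Real.one_le_exp hε)

open Classical in
/-- The unnormalized probability of the subcollection `S` on input `x`: subcollections with
infinite closure are favoured for their size and for the number of inputs in their closure. -/
noncomputable def closureWeight {n k : ℕ} (L : Fin k → Set ℕ) (a ε : ℝ) (x : Fin n → ℕ)
    (S : Finset (Fin k)) : ℝ :=
  if (Cl L S).Infinite then a ^ S.card * Real.exp (ε / 2 * hitCount (Cl L S) x) else 0

section closureWeight

variable {n k : ℕ} (L : Fin k → Set ℕ) {a ε : ℝ}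

theorem closureWeight_nonneg (ha : 0 < a) (x : Fin n → ℕ) (S : Finset (Fin k)) :
    0 ≤ closureWeight L a ε x S := by
  unfold closureWeight
  split_ifs <;> positivity

theorem sum_closureWeight_pos (ha : 0 < a) (x : Fin n → ℕ) :
    0 < ∑ S, closureWeight L a ε x S := by
  refine Finset.sum_pos' (fun S _ => closureWeight_nonneg L ha x S) ⟨∅, Finset.mem_univ _, ?_⟩
  have h : (Cl L ∅).Infinite := by simpa [Cl] using Set.infinite_univ
  rw [closureWeight, if_pos h]
  positivity

theorem closureWeight_le_of_neighboring (ha : 0 < a) (hε : 0 ≤ ε) {x x' : Fin n → ℕ}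
    (h : NeighboringFin x x') (S : Finset (Fin k)) :
    closureWeight L a ε x S ≤ Real.exp (ε / 2) * closureWeight L a ε x' S := by
  unfold closureWeight
  split_ifs with hS
  · rw [mul_left_comm, ← Real.exp_add]
    refine mul_le_mul_of_nonneg_left (Real.exp_le_exp.2 ?_) (by positivity)
    have h1 : (hitCount (Cl L S) x : ℝ) ≤ hitCount (Cl L S) x' + 1 := by
      exact_mod_cast hitCount_le_add_one (Cl L S) h
    nlinarith
  · simp

theorem closureWeight_le_insert {d : ℕ} (hd : IsClosureBound L d) (ha : 0 < a) (hε : 0 ≤ ε)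
    {i : Fin k} {x : Fin n → ℕ} (hx : Function.Injective x) (hxi : Set.range x ⊆ L i)
    {S : Finset (Fin k)} (hi : i ∉ S) :
    closureWeight L a ε x S ≤
      a⁻¹ * closureWeight L a ε x (insert i S) + a ^ S.card * Real.exp (ε / 2 * d) := by
  by_cases hins : (Cl L (insert i S)).Infinite
  · have hS : (Cl L S).Infinite := hins.mono (by rw [Cl_insert]; exact Set.inter_subset_right)
    rw [closureWeight, closureWeight, if_pos hS, if_pos hins, hitCount_Cl_insert L S hxi,
      Finset.card_insert_of_notMem hi, pow_succ]
    have : 0 ≤ a ^ S.card * Real.exp (ε / 2 * d) := by positivity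
    have e : a⁻¹ * (a ^ S.card * a * Real.exp (ε / 2 * hitCount (Cl L S) x)) =
        a ^ S.card * Real.exp (ε / 2 * hitCount (Cl L S) x) := by
      field_simp
    rw [e]
    linarith
  · have hcard : ((Cl L (insert i S)).ncard : ℤ) ≤ d := (hd _).resolve_left hins
    have hhit : hitCount (Cl L S) x ≤ d := by
      rw [← hitCount_Cl_insert L S hxi]
      exact (hitCount_le_ncard (Set.not_infinite.1 hins) hx).trans (by exact_mod_cast hcard)
    have hhit' : (hitCount (Cl L S) x : ℝ) ≤ d := by exact_mod_cast hhit
    rw [closureWeight, closureWeight, if_neg hins, mul_zero, zero_add]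
    split_ifs
    · gcongr
    · positivity

/-- With an appropriate parameter, subcollections missing the target carry a small share of the
total weight. -/
theorem sum_closureWeight_notMem_le {d : ℕ} (hd : IsClosureBound L d) (ha : 0 < a) (hε : 0 ≤ ε)
    (hpow : (a + 1) ^ k * Real.exp (ε / 2 * d) ≤ Real.exp (ε / 2 * n))
    {i : Fin k} (hi : (L i).Infinite) {x : Fin n → ℕ} (hx : Function.Injective x)
    (hxi : Set.range x ⊆ L i) :
    ∑ S with i ∉ S, closureWeight L a ε x S ≤ 2 / a * ∑ S, closureWeight L a ε x S := by
  classical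
  have hnn := closureWeight_nonneg (ε := ε) L ha x
  have hcl : Cl L {i} = L i := by simp [Cl]
  have hsingle : a * Real.exp (ε / 2 * n) ≤ ∑ S, closureWeight L a ε x S := by
    refine le_trans (le_of_eq ?_)
      (Finset.single_le_sum (fun S _ => hnn S) (Finset.mem_univ ({i} : Finset (Fin k))))
    rw [closureWeight, hcl, if_pos hi, hitCount_eq_of_range_subset hxi, Finset.card_singleton,
      pow_one]
  have hinsert : ∑ S with i ∉ S, closureWeight L a ε x (insert i S) ≤
      ∑ S, closureWeight L a ε x S := by
    rw [← Finset.sum_image (f := closureWeight L a ε x) (g := insert i)]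
    · exact Finset.sum_le_sum_of_subset_of_nonneg (Finset.subset_univ _) fun S _ _ => hnn S
    · intro S hS T hT hST
      simp only [Finset.coe_filter, Finset.mem_univ, true_and, Set.mem_ofPred_eq] at hS hT
      rw [← Finset.erase_insert hS, ← Finset.erase_insert hT]
      exact congrArg (Finset.erase · i) hST
  have htail : ∑ S : Finset (Fin k) with i ∉ S, a ^ S.card ≤ (a + 1) ^ k := by
    refine (Finset.sum_le_sum_of_subset_of_nonneg (Finset.subset_univ _)
      fun S _ _ => by positivity).trans (le_of_eq ?_)
    simpa using Fin.sum_pow_mul_eq_add_pow (n := k) a 1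
  calc ∑ S with i ∉ S, closureWeight L a ε x S
      ≤ ∑ S with i ∉ S, (a⁻¹ * closureWeight L a ε x (insert i S) +
          a ^ S.card * Real.exp (ε / 2 * d)) := by
        refine Finset.sum_le_sum fun S hS => ?_
        exact closureWeight_le_insert L hd ha hε hx hxi (Finset.mem_filter.1 hS).2
    _ = a⁻¹ * (∑ S with i ∉ S, closureWeight L a ε x (insert i S)) +
          (∑ S : Finset (Fin k) with i ∉ S, a ^ S.card) * Real.exp (ε / 2 * d) := by
        rw [Finset.sum_add_distrib, Finset.mul_sum, Finset.sum_mul]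
    _ ≤ a⁻¹ * (∑ S, closureWeight L a ε x S) + Real.exp (ε / 2 * n) := by
        refine add_le_add (by gcongr) (le_trans ?_ hpow)
        gcongr
    _ ≤ a⁻¹ * (∑ S, closureWeight L a ε x S) + a⁻¹ * ∑ S, closureWeight L a ε x S := by
        gcongr
        rw [inv_mul_eq_div, le_div_iff₀ ha]
        linarith
    _ = 2 / a * ∑ S, closureWeight L a ε x S := by ring

end closureWeight

/-- The mass that a mixture gives to an event is small when the label is rarely bad and the
components at good labels give the event small mass. -/
theorem toOuterMeasure_bind_weightPMF_le {ι Y : Type*} [Fintype ι] {w : ι → ℝ}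
    (hw : ∀ i, 0 ≤ w i) (hZ : 0 < ∑ i, w i) (κ : ι → PMF Y) (E : Set Y) (s : ι → Prop)
    [DecidablePred s] {η δ : ℝ} (hη : 0 ≤ η) (hδ : 0 ≤ δ)
    (hs : ∑ i with s i, w i ≤ η * ∑ i, w i)
    (hκ : ∀ i, w i ≠ 0 → ¬ s i → (κ i).toOuterMeasure E ≤ ENNReal.ofReal δ) :
    ((weightPMF w hw hZ).bind κ).toOuterMeasure E ≤ ENNReal.ofReal (η + δ) := by
  have hle : ∀ (p : PMF Y), p.toOuterMeasure E ≤ 1 := fun p => by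
    rw [← p.tsum_coe, p.toOuterMeasure_apply]
    exact ENNReal.tsum_le_tsum fun y => Set.indicator_le_self E p y
  have hone : ∑ i, weightPMF w hw hZ i = 1 := by
    rw [← tsum_fintype (L := .unconditional _)]; exact PMF.tsum_coe _
  rw [PMF.toOuterMeasure_bind_apply, tsum_fintype, ← Finset.sum_filter_add_sum_filter_not _ s,
    ENNReal.ofReal_add hη hδ]
  refine add_le_add ?_ ?_
  · calc _ ≤ ∑ i with s i, weightPMF w hw hZ i :=
          Finset.sum_le_sum fun i _ => mul_le_of_le_one_right (zero_le) (hle _)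
      _ = ENNReal.ofReal ((∑ i with s i, w i) / ∑ i, w i) := by
          simp only [weightPMF, PMF.ofFintype_apply]
          rw [← ENNReal.ofReal_sum_of_nonneg fun i _ => div_nonneg (hw i) hZ.le,
            ← Finset.sum_div]
      _ ≤ ENNReal.ofReal η := ENNReal.ofReal_le_ofReal (by rwa [div_le_iff₀ hZ])
  · calc _ ≤ ∑ i with ¬ s i, weightPMF w hw hZ i * ENNReal.ofReal δ := by
          refine Finset.sum_le_sum fun i hi => ?_
          by_cases h0 : w i = 0
          · simp [weightPMF, h0]
          · gcongr
            exact hκ i h0 (Finset.mem_filter.1 hi).2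
      _ ≤ ∑ i, weightPMF w hw hZ i * ENNReal.ofReal δ :=
          Finset.sum_le_sum_of_subset (Finset.subset_univ _)
      _ = ENNReal.ofReal δ := by rw [← Finset.sum_mul, hone, one_mul]

theorem ofReal_one_sub_le_toOuterMeasure {Y : Type*} (p : PMF Y) {E : Set Y} {η : ℝ}
    (hη : 0 ≤ η) (h : p.toOuterMeasure Eᶜ ≤ ENNReal.ofReal η) :
    ENNReal.ofReal (1 - η) ≤ p.toOuterMeasure E := by
  rw [ENNReal.ofReal_sub _ hη, ENNReal.ofReal_one, tsub_le_iff_right]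
  have hone : p.toOuterMeasure Set.univ = 1 :=
    (p.toOuterMeasure_apply_eq_one_iff _).2 (Set.subset_univ _)
  calc (1 : ENNReal) = p.toOuterMeasure (E ∪ Eᶜ) := by rw [Set.union_compl_self, hone]
    _ ≤ p.toOuterMeasure E + p.toOuterMeasure Eᶜ := MeasureTheory.measure_union_le _ _
    _ ≤ _ := by gcongr

/-- For a finite collection of `k` infinite languages of closure
dimension `d`, there is an ε-DP algorithm on `n` inputs that, given distinct
elements of a target language, outputs an unseen element of the target with
probability at least `1 − 5·exp(−ε(n−d)/(2k))`. -/
theorem stmt2 (k : ℕ) (hk : 0 < k) (L : Fin k → Set ℕ) (hL : ∀ i, (L i).Infinite)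
    (d : ℕ) (hdim : HasClosureDim L (d : ℤ)) (ε : ℝ) (hε : 0 < ε) (n : ℕ) :
    ∃ A : (Fin n → ℕ) → PMF ℕ, DPFin ε A ∧
      ∀ i : Fin k, ∀ x : Fin n → ℕ, Function.Injective x → Set.range x ⊆ L i →
        ENNReal.ofReal (1 - 5 * Real.exp (-(ε * ((n : ℝ) - (d : ℝ))) / (2 * k))) ≤
          (A x).toOuterMeasure (L i \ Set.range x) := by
  classical
  set t : ℝ := ε * ((n : ℝ) - d) / (2 * k) with ht
  have hneg : -(ε * ((n : ℝ) - (d : ℝ))) / (2 * k) = -t := by rw [ht, neg_div]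
  rw [hneg]
  have hk' : (k : ℝ) ≠ 0 := by exact_mod_cast hk.ne'
  have hpos : 0 < Real.exp (-t) := Real.exp_pos _
  have hmul : Real.exp t * Real.exp (-t) = 1 := by rw [← Real.exp_add]; simp
  rcases le_or_gt 1 (5 * Real.exp (-t)) with h5 | h5
  · refine ⟨fun _ => PMF.pure 0, DPFin_const hε.le _, fun i x _ _ => ?_⟩
    rw [ENNReal.ofReal_of_nonpos (by linarith)]
    exact zero_le
  set a : ℝ := Real.exp t - 1 with ha_def
  have ha : 0 < a := by nlinarith [Real.exp_pos t]
  have hδ : 0 < 5 / 2 * Real.exp (-t) := by positivity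
  have hshare : 2 / a ≤ 5 / 2 * Real.exp (-t) := by
    rw [div_le_iff₀ ha]
    nlinarith
  have hpow : (a + 1) ^ k * Real.exp (ε / 2 * d) ≤ Real.exp (ε / 2 * n) := by
    rw [ha_def, sub_add_cancel, ← Real.exp_nat_mul, ← Real.exp_add]
    refine Real.exp_le_exp.2 (le_of_eq ?_)
    rw [ht]
    field_simp
    ring
  have hκ : ∀ S, ∃ p : PMF ℕ, (Cl L S).Infinite → ∀ x : Fin n → ℕ,
      p.toOuterMeasure (Cl L S \ Set.range x)ᶜ ≤
        ENNReal.ofReal (5 / 2 * Real.exp (-t)) := fun S => by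
    by_cases hS : (Cl L S).Infinite
    · obtain ⟨p, hp⟩ := exists_pmf_compl_diff_range_le hS n hδ
      exact ⟨p, fun _ => hp⟩
    · exact ⟨PMF.pure 0, fun h => absurd h hS⟩
  choose κ hκ using hκ
  refine ⟨fun x => (weightPMF (closureWeight L a ε x) (closureWeight_nonneg L ha x)
    (sum_closureWeight_pos L ha x)).bind κ, DPFin_bind κ fun x x' h => ?_, fun i x hx hxi => ?_⟩
  · have h' : NeighboringFin x' x := by
      obtain ⟨j, hj, hm⟩ := h
      exact ⟨j, hj.symm, fun m hmj => (hm m hmj).symm⟩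
    exact weightPMF_le_of_le _ _ _ _ (closureWeight_le_of_neighboring L ha hε.le h)
      (closureWeight_le_of_neighboring L ha hε.le h')
  · refine ofReal_one_sub_le_toOuterMeasure _ (by positivity) ?_
    have e : 5 * Real.exp (-t) = 5 / 2 * Real.exp (-t) + 5 / 2 * Real.exp (-t) := by ring
    rw [e]
    refine toOuterMeasure_bind_weightPMF_le _ _ κ _ (fun S => i ∉ S) hδ.le hδ.le ?_ ?_
    · refine (sum_closureWeight_notMem_le L hdim.1 ha hε.le hpow (hL i) hx hxi).trans ?_
      exact mul_le_mul_of_nonneg_right hshare (sum_closureWeight_pos L ha x).le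
    · intro S hS hiS
      have hinf : (Cl L S).Infinite := by
        by_contra hfin
        exact hS (if_neg hfin)
      refine le_trans (MeasureTheory.measure_mono ?_) (hκ S hinf x)
      exact Set.compl_subset_compl.2 (Set.sdiff_subset_sdiff_left (Cl_subset L (not_not.1 hiS)))
end

section
/- There exist absolute constants C, c > 0 such that the following holds. Let 𝓛 = {L_1, …, L_k} be a finite collection of infinite subsets of ℕ with closure dimension d and let ε > 0. Then there exists a prefix-causal map A from input streams to probability measures on output streams that is ε-differentially private in the continual release model and such that for every i ∈ {1,…,k}, every duplicate-free enumeration e of L_i (i.e., e injective with range equal to L_i), and every integer m ≥ d + 2, A(e)({w : for all n ≥ m, w(n) ∈ L_i \ {e(0), e(1), …, e(n)}}) ≥ 1 − C·exp(−c·ε·(m−d)/(k·(log(m−d))²)). -/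
open MeasureTheory

/-- Two streams are neighboring if they differ in exactly one coordinate. -/
def Neighboring (x x' : ℕ → ℕ) : Prop :=
  ∃ j, x j ≠ x' j ∧ ∀ m, m ≠ j → x m = x' m

/-- A continual-release algorithm is prefix-causal if streams agreeing on their
first `n` coordinates induce the same distribution on the first `n` outputs. -/
def PrefixCausal (A : (ℕ → ℕ) → Measure (ℕ → ℕ)) : Prop :=
  ∀ x x' : ℕ → ℕ, ∀ n : ℕ, (∀ m < n, x m = x' m) →
    (A x).map (fun w (m : Fin n) => w m.val) = (A x').map (fun w (m : Fin n) => w m.val)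

/-- ε-differential privacy in the continual release model. -/
def DPCR (ε : ℝ) (A : (ℕ → ℕ) → Measure (ℕ → ℕ)) : Prop :=
  ∀ x x' : ℕ → ℕ, Neighboring x x' → ∀ E : Set (ℕ → ℕ), MeasurableSet E →
    A x E ≤ ENNReal.ofReal (Real.exp ε) * A x' E

/-- An enumeration of a language `K`. -/
def IsEnumeration (K : Set ℕ) (e : ℕ → ℕ) : Prop :=
  (∀ n, e n ∈ K) ∧ ∀ y ∈ K, ∃ n, e n = y

open scoped ENNReal

section Domination

/-- A multiplicative comparison of finite measures extends from a generating ring of sets to the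
whole σ-algebra. -/
theorem measure_le_smul_of_isSetRing {α : Type*} [mα : MeasurableSpace α] {μ ν : Measure α}
    [IsFiniteMeasure μ] [IsFiniteMeasure ν] {c : ℝ≥0∞} (hc : c ≠ ∞) {C : Set (Set α)}
    (hC : IsSetRing C) (huniv : Set.univ ∈ C) (hgen : mα = MeasurableSpace.generateFrom C)
    (h : ∀ s ∈ C, μ s ≤ c * ν s) : μ ≤ c • ν := by
  refine Measure.le_iff.2 fun s hs => ?_
  rw [Measure.smul_apply, smul_eq_mul]
  refine ENNReal.le_of_forall_pos_le_add fun δ hδ _ => ?_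
  have hc1 : (1 + c) ≠ ∞ := by simp [hc]
  have hc0 : (1 + c) ≠ 0 := by simp
  have hpos : (0 : ℝ≥0∞) < δ / (1 + c) :=
    ENNReal.div_pos (by exact_mod_cast hδ.ne') hc1
  obtain ⟨t, htC, ht⟩ := exists_measure_symmDiff_lt_of_generateFrom_isSetRing (μ := μ + ν) hC
    ⟨{Set.univ}, by simp, by simpa using huniv, by simp⟩ hgen hs hpos
  rw [Measure.add_apply] at ht
  have h1 : μ s ≤ μ t + μ (symmDiff t s) := by
    refine (measure_mono ?_).trans (measure_union_le _ _)
    intro a ha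
    by_cases hat : a ∈ t
    · exact Or.inl hat
    · exact Or.inr (Or.inr ⟨ha, hat⟩)
  have h2 : ν t ≤ ν s + ν (symmDiff t s) := by
    refine (measure_mono ?_).trans (measure_union_le _ _)
    intro a ha
    by_cases hat : a ∈ s
    · exact Or.inl hat
    · exact Or.inr (Or.inl ⟨ha, hat⟩)
  have h3 : μ (symmDiff t s) + c * ν (symmDiff t s) ≤ δ := by
    calc μ (symmDiff t s) + c * ν (symmDiff t s)
        ≤ (1 + c) * (μ (symmDiff t s) + ν (symmDiff t s)) := by
          rw [add_mul, one_mul, mul_add]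
          exact add_le_add le_self_add le_add_self
      _ ≤ (1 + c) * (δ / (1 + c)) := by gcongr
      _ = δ := ENNReal.mul_div_cancel hc0 hc1
  calc μ s ≤ c * ν t + μ (symmDiff t s) := h1.trans (by gcongr; exact h t htC)
    _ ≤ c * (ν s + ν (symmDiff t s)) + μ (symmDiff t s) := by gcongr
    _ = c * ν s + (μ (symmDiff t s) + c * ν (symmDiff t s)) := by ring
    _ ≤ c * ν s + δ := by gcongr

/-- On a finite space, a multiplicative comparison of measures may be checked on points. -/
theorem measure_le_smul_of_singleton {α : Type*} [Finite α] [MeasurableSpace α]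
    [MeasurableSingletonClass α] {μ ν : Measure α} {c : ℝ≥0∞}
    (h : ∀ a, μ {a} ≤ c * ν {a}) : μ ≤ c • ν := by
  have := Fintype.ofFinite α
  refine Measure.le_iff.2 fun s _ => ?_
  lift s to Finset α using s.toFinite
  rw [Measure.smul_apply, smul_eq_mul, ← sum_measure_singleton, ← sum_measure_singleton,
    Finset.mul_sum]
  exact Finset.sum_le_sum fun a _ => h a

theorem pi_le_smul_pi {ι : Type*} [Fintype ι] {X : ι → Type*} [∀ i, Finite (X i)]
    [∀ i, MeasurableSpace (X i)] [∀ i, MeasurableSingletonClass (X i)]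
    {μ ν : ∀ i, Measure (X i)} [∀ i, SigmaFinite (μ i)] [∀ i, SigmaFinite (ν i)]
    {c : ι → ℝ≥0∞} (h : ∀ i, μ i ≤ c i • ν i) :
    Measure.pi μ ≤ (∏ i, c i) • Measure.pi ν := by
  refine measure_le_smul_of_singleton fun f => ?_
  rw [Measure.pi_singleton, Measure.pi_singleton, ← Finset.prod_mul_distrib]
  exact Finset.prod_le_prod' fun i _ => h i {f i}

theorem infinitePi_le_smul_infinitePi {ι : Type*} {X : ι → Type*} [∀ i, Finite (X i)]
    [∀ i, MeasurableSpace (X i)] [∀ i, MeasurableSingletonClass (X i)]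
    {μ ν : ∀ i, Measure (X i)} [∀ i, IsProbabilityMeasure (μ i)]
    [∀ i, IsProbabilityMeasure (ν i)] {c : ι → ℝ≥0∞} {b : ℝ≥0∞} (hb : b ≠ ∞)
    (h : ∀ i, μ i ≤ c i • ν i) (hcb : ∀ I : Finset ι, ∏ i ∈ I, c i ≤ b) :
    Measure.infinitePi μ ≤ b • Measure.infinitePi ν := by
  refine measure_le_smul_of_isSetRing hb isSetRing_measurableCylinders
    (univ_mem_measurableCylinders _) generateFrom_measurableCylinders.symm fun s hs => ?_
  obtain ⟨I, S, hS, rfl⟩ := (mem_measurableCylinders s).1 hs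
  rw [Measure.infinitePi_cylinder _ hS, Measure.infinitePi_cylinder _ hS]
  refine (pi_le_smul_pi (fun i : I => h i) S).trans ?_
  rw [Measure.smul_apply, smul_eq_mul, Finset.prod_coe_sort I c]
  gcongr
  exact hcb I

end Domination

section ExponentialMechanism

variable {α : Type*} [Fintype α]

/-- The distribution on a finite type with probabilities proportional to `w`. -/
noncomputable def proportionalPMF (w : α → ℝ) (hw : ∀ a, 0 ≤ w a) (hpos : 0 < ∑ a, w a) :
    PMF α :=
  PMF.ofFintype (fun a => ENNReal.ofReal (w a / ∑ b, w b)) (by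
    rw [← ENNReal.ofReal_sum_of_nonneg fun a _ => div_nonneg (hw a) hpos.le, ← Finset.sum_div,
      div_self hpos.ne', ENNReal.ofReal_one])

variable [MeasurableSpace α] [MeasurableSingletonClass α]

theorem proportionalPMF_toMeasure_le {w : α → ℝ} (hw : ∀ a, 0 ≤ w a) (hpos : 0 < ∑ a, w a)
    (s : Finset α) {b : ℝ} (h : ∑ a ∈ s, w a ≤ b * ∑ a, w a) :
    (proportionalPMF w hw hpos).toMeasure s ≤ ENNReal.ofReal b := by
  rw [PMF.toMeasure_apply_finset]
  simp only [proportionalPMF, PMF.ofFintype_apply]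
  rw [← ENNReal.ofReal_sum_of_nonneg fun a _ => div_nonneg (hw a) hpos.le, ← Finset.sum_div]
  exact ENNReal.ofReal_le_ofReal ((div_le_iff₀ hpos).2 h)

theorem proportionalPMF_le_smul {w w' : α → ℝ} (hw : ∀ a, 0 ≤ w a) (hpos : 0 < ∑ a, w a)
    (hw' : ∀ a, 0 ≤ w' a) (hpos' : 0 < ∑ a, w' a) {b : ℝ} (hb : 0 ≤ b)
    (h : ∀ a, w a ≤ b * w' a) (h' : ∀ a, w' a ≤ b * w a) :
    (proportionalPMF w hw hpos).toMeasure ≤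
      ENNReal.ofReal (b * b) • (proportionalPMF w' hw' hpos').toMeasure := by
  refine measure_le_smul_of_singleton fun a => ?_
  rw [PMF.toMeasure_apply_singleton _ _ (measurableSet_singleton a),
    PMF.toMeasure_apply_singleton _ _ (measurableSet_singleton a)]
  simp only [proportionalPMF, PMF.ofFintype_apply]
  rw [← ENNReal.ofReal_mul (by positivity)]
  refine ENNReal.ofReal_le_ofReal ?_
  have hsum : ∑ a, w' a ≤ b * ∑ a, w a := by
    rw [Finset.mul_sum]
    exact Finset.sum_le_sum fun a _ => h' a
  rw [mul_div_assoc', div_le_div_iff₀ hpos hpos']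
  calc w a * ∑ a, w' a ≤ (b * w' a) * (b * ∑ a, w a) :=
        mul_le_mul (h a) hsum hpos'.le (mul_nonneg hb (hw' a))
    _ = b * b * w' a * ∑ a, w a := by ring

end ExponentialMechanism

section Selection

variable {k : ℕ} (L : Fin k → Set ℕ)

open Classical in
/-- The number of the first `N` examples lying outside the closure of `S`. -/
noncomputable def errCount (N : ℕ) (x : ℕ → ℕ) (S : Finset (Fin k)) : ℕ :=
  ((Finset.range N).filter fun t => x t ∉ Cl L S).card

open Classical in
/-- The weight of a subcollection in the exponential mechanism at inverse temperature `η`: only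
subcollections with infinite closure count, large ones being favoured by `β` per language. -/
noncomputable def selWeight (η β : ℝ) (N : ℕ) (x : ℕ → ℕ) (S : Finset (Fin k)) : ℝ :=
  if (Cl L S).Infinite then Real.exp (η * (β * S.card - errCount L N x S)) else 0

variable {L}

theorem mem_Cl {S : Finset (Fin k)} {y : ℕ} : y ∈ Cl L S ↔ ∀ i ∈ S, y ∈ L i := by
  simp [Cl]

theorem errCount_le_succ {x x' : ℕ → ℕ} (h : Neighboring x x') (N : ℕ) (S : Finset (Fin k)) :
    errCount L N x' S ≤ errCount L N x S + 1 := by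
  classical
  obtain ⟨j, -, hj⟩ := h
  refine (Finset.card_le_card fun t ht => ?_).trans
    (Finset.card_insert_le j ((Finset.range N).filter fun t => x t ∉ Cl L S))
  by_cases htj : t = j
  · exact Finset.mem_insert.2 (Or.inl htj)
  · simp only [Finset.mem_insert, Finset.mem_filter] at ht ⊢
    rw [hj t htj]
    exact Or.inr ht

theorem Neighboring.symm {x x' : ℕ → ℕ} (h : Neighboring x x') : Neighboring x' x := by
  obtain ⟨j, hne, hj⟩ := h
  exact ⟨j, hne.symm, fun m hm => (hj m hm).symm⟩

theorem errCount_congr {x x' : ℕ → ℕ} {N : ℕ} (h : ∀ t < N, x t = x' t) (S : Finset (Fin k)) :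
    errCount L N x S = errCount L N x' S := by
  classical
  unfold errCount
  congr 1
  refine Finset.filter_congr fun t ht => ?_
  rw [h t (Finset.mem_range.1 ht)]

theorem selWeight_nonneg (η β : ℝ) (N : ℕ) (x : ℕ → ℕ) (S : Finset (Fin k)) :
    0 ≤ selWeight L η β N x S := by
  unfold selWeight
  split_ifs <;> positivity

theorem sum_selWeight_pos (η β : ℝ) (N : ℕ) (x : ℕ → ℕ) :
    0 < ∑ S, selWeight L η β N x S := by
  refine Finset.sum_pos' (fun S _ => selWeight_nonneg η β N x S) ⟨∅, Finset.mem_univ _, ?_⟩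
  have : (Cl L ∅).Infinite := by simpa [Cl] using Set.infinite_univ
  rw [selWeight, if_pos this]
  positivity

theorem selWeight_le_of_neighboring {η : ℝ} (hη : 0 ≤ η) (β : ℝ) (N : ℕ) {x x' : ℕ → ℕ}
    (h : Neighboring x x') (S : Finset (Fin k)) :
    selWeight L η β N x S ≤ Real.exp η * selWeight L η β N x' S := by
  unfold selWeight
  split_ifs
  · rw [← Real.exp_add, Real.exp_le_exp]
    have : (errCount L N x' S : ℝ) ≤ errCount L N x S + 1 := by
      exact_mod_cast errCount_le_succ h N S
    nlinarith
  · simp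

/-- If adding a language containing all examples makes the closure finite, then many examples
lie outside the closure. -/
theorem le_errCount_of_finite_insert {d T : ℕ} (hd : IsClosureBound L (d : ℤ)) {x : ℕ → ℕ}
    (hx : Set.InjOn x (Set.Iio (d + T))) {i : Fin k} (hxi : ∀ t < d + T, x t ∈ L i)
    {S : Finset (Fin k)} (hS : ¬ (Cl L (insert i S)).Infinite) :
    T ≤ errCount L (d + T) x S := by
  classical
  have hcard := (hd (insert i S)).resolve_left hS
  have hfin : (Cl L (insert i S)).Finite := Set.not_infinite.1 hS
  have hin : ((Finset.range (d + T)).filter fun t => x t ∈ Cl L S).card ≤ d := by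
    have : ((Finset.range (d + T)).filter fun t => x t ∈ Cl L S).card ≤
        (Cl L (insert i S)).ncard := by
      rw [← Set.ncard_coe_finset]
      refine Set.ncard_le_ncard_of_injOn x (fun t ht => ?_) (fun a ha b hb hab => ?_) hfin
      · simp only [Finset.coe_filter, Finset.mem_range, Set.mem_ofPred_eq] at ht
        refine mem_Cl.2 fun j hj => ?_
        rcases Finset.mem_insert.1 hj with rfl | hj
        · exact hxi t ht.1
        · exact mem_Cl.1 ht.2 j hj
      · simp only [Finset.coe_filter, Finset.mem_range, Set.mem_ofPred_eq] at ha hb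
        exact hx ha.1 hb.1 hab
    omega
  have htot := Finset.card_filter_add_card_filter_not (s := Finset.range (d + T))
    (fun t => x t ∈ Cl L S)
  rw [Finset.card_range] at htot
  unfold errCount
  omega

/-- The total weight of the subcollections missing a language that contains all examples. -/
theorem sum_selWeight_notMem_le {d T : ℕ} (hd : IsClosureBound L (d : ℤ)) {x : ℕ → ℕ}
    (hx : Set.InjOn x (Set.Iio (d + T))) {i : Fin k} (hi : (L i).Infinite)
    (hxi : ∀ t < d + T, x t ∈ L i) {η β : ℝ} (hη : 0 ≤ η) (hβ : 0 ≤ β)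
    (hT : 2 * (k * β) = T) :
    ∑ S with i ∉ S, selWeight L η β (d + T) x S ≤
      (Real.exp (-(η * β)) + (2 * Real.exp (-(η * β))) ^ k) *
        ∑ S, selWeight L η β (d + T) x S := by
  classical
  have hpoint : ∀ S : Finset (Fin k), i ∉ S → selWeight L η β (d + T) x S ≤
      Real.exp (-(η * β)) * selWeight L η β (d + T) x (insert i S) +
        Real.exp (-(η * β)) ^ k := by
    intro S hiS
    by_cases hS : (Cl L S).Infinite
    swap
    · rw [selWeight, if_neg hS]
      have := selWeight_nonneg (L := L) η β (d + T) x (insert i S)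
      positivity
    by_cases hS' : (Cl L (insert i S)).Infinite
    · have herr : errCount L (d + T) x (insert i S) = errCount L (d + T) x S := by
        unfold errCount
        congr 1
        refine Finset.filter_congr fun t ht => not_congr ?_
        simp [mem_Cl, hxi t (Finset.mem_range.1 ht)]
      refine le_add_of_le_of_nonneg ?_ (by positivity)
      rw [selWeight, selWeight, if_pos hS, if_pos hS', ← Real.exp_add, herr,
        Finset.card_insert_of_notMem hiS]
      refine (congrArg Real.exp ?_).le
      push_cast
      ring
    · have herr : (T : ℝ) ≤ errCount L (d + T) x S := by
        exact_mod_cast le_errCount_of_finite_insert hd hx hxi hS'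
      have hcard : (S.card : ℝ) ≤ k := by
        exact_mod_cast (Finset.card_le_univ S).trans_eq (Fintype.card_fin k)
      have hnn := selWeight_nonneg (L := L) η β (d + T) x (insert i S)
      refine le_add_of_nonneg_of_le (by positivity) ?_
      rw [selWeight, if_pos hS, ← Real.exp_nat_mul, Real.exp_le_exp]
      have h1 : β * S.card ≤ k * β := by nlinarith
      have h2 : η * (β * S.card - errCount L (d + T) x S) ≤ η * (-(k * β)) :=
        mul_le_mul_of_nonneg_left (by linarith) hη
      linarith
  have hone : 1 ≤ ∑ S, selWeight L η β (d + T) x S := by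
    refine le_trans ?_ (Finset.single_le_sum
      (fun S _ => selWeight_nonneg (L := L) η β (d + T) x S) (Finset.mem_univ {i}))
    have hCl : Cl L {i} = L i := by simp [Cl]
    have herr : errCount L (d + T) x {i} = 0 := by
      unfold errCount
      rw [Finset.card_eq_zero, Finset.filter_eq_empty_iff]
      intro t ht
      rw [hCl]
      exact not_not.2 (hxi t (Finset.mem_range.1 ht))
    rw [selWeight, hCl, if_pos hi, herr, Finset.card_singleton]
    refine Real.one_le_exp ?_
    simp only [Nat.cast_one, Nat.cast_zero, mul_one, sub_zero]
    positivity
  have hinj : ∑ S with i ∉ S, selWeight L η β (d + T) x (insert i S) ≤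
      ∑ S, selWeight L η β (d + T) x S := by
    rw [← Finset.sum_image (s := Finset.univ.filter fun S : Finset (Fin k) => i ∉ S)
      (g := insert i) (f := selWeight L η β (d + T) x)]
    · exact Finset.sum_le_sum_of_subset_of_nonneg (Finset.subset_univ _)
        fun S _ _ => selWeight_nonneg η β (d + T) x S
    · intro a ha b hb hab
      simp only [Finset.coe_filter, Finset.mem_univ, true_and, Set.mem_ofPred_eq] at ha hb
      rw [← Finset.erase_insert ha, ← Finset.erase_insert hb, hab]
  have hcard : ((Finset.univ.filter fun S : Finset (Fin k) => i ∉ S).card : ℝ) ≤ 2 ^ k := by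
    have : (Finset.univ.filter fun S : Finset (Fin k) => i ∉ S).card ≤ 2 ^ k := by
      refine (Finset.card_le_univ _).trans_eq ?_
      simp
    exact_mod_cast this
  calc ∑ S with i ∉ S, selWeight L η β (d + T) x S
      ≤ ∑ S with i ∉ S, (Real.exp (-(η * β)) * selWeight L η β (d + T) x (insert i S) +
        Real.exp (-(η * β)) ^ k) :=
        Finset.sum_le_sum fun S hS => hpoint S (Finset.mem_filter.1 hS).2
    _ = Real.exp (-(η * β)) * ∑ S with i ∉ S, selWeight L η β (d + T) x (insert i S) +
        (Finset.univ.filter fun S : Finset (Fin k) => i ∉ S).card *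
          Real.exp (-(η * β)) ^ k := by
        rw [Finset.sum_add_distrib, ← Finset.mul_sum, Finset.sum_const, nsmul_eq_mul]
    _ ≤ Real.exp (-(η * β)) * ∑ S, selWeight L η β (d + T) x S +
        (2 ^ k * Real.exp (-(η * β)) ^ k) * ∑ S, selWeight L η β (d + T) x S := by
        refine add_le_add (by gcongr) ((?_ : _ ≤ _).trans
          (le_mul_of_one_le_right (by positivity) hone))
        gcongr
    _ = _ := by rw [mul_pow]; ring

end Selection

section Generator

variable {k : ℕ} (L : Fin k → Set ℕ) (ε : ℝ) (d : ℕ)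

/-- The law of the subcollection selected in round `r`, based on the first `d + 2 ^ r` examples. -/
noncomputable def selMeasure (x : ℕ → ℕ) (r : ℕ) : Measure (Finset (Fin k)) :=
  (proportionalPMF
    (selWeight L (ε / (2 * ((r + 1) * (r + 2)))) (2 ^ r / (2 * k)) (d + 2 ^ r) x)
    (selWeight_nonneg _ _ _ x) (sum_selWeight_pos _ _ _ x)).toMeasure

instance (x : ℕ → ℕ) (r : ℕ) : IsProbabilityMeasure (selMeasure L ε d x r) := by
  unfold selMeasure
  infer_instance

/-- The number of elements among which the output of step `n` is drawn. -/
noncomputable def sampleSize (n : ℕ) : ℕ := (n + 1) * 2 ^ (n + 1) * ⌈Real.exp (ε * n)⌉₊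

theorem sampleSize_pos (n : ℕ) : 0 < sampleSize ε n := by
  have := Nat.ceil_pos.2 (Real.exp_pos (ε * n))
  unfold sampleSize
  positivity

/-- The law of the index of the element output at step `n`. -/
noncomputable def sampleMeasure (n : ℕ) : Measure ℕ :=
  (PMF.uniformOfFinset (Finset.range (sampleSize ε n))
    (Finset.nonempty_range_iff.2 (sampleSize_pos ε n).ne')).toMeasure

instance (n : ℕ) : IsProbabilityMeasure (sampleMeasure ε n) := by
  unfold sampleMeasure
  infer_instance

/-- The output stream determined by the selected subcollections and the sampled indices. -/
noncomputable def generate (p : (ℕ → Finset (Fin k)) × (ℕ → ℕ)) (n : ℕ) : ℕ :=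
  if d < n then Nat.nth (· ∈ Cl L (p.1 (Nat.log 2 (n - d)))) (p.2 n) else 0

/-- The joint law of the selected subcollections and the sampled indices. -/
noncomputable def randomness (x : ℕ → ℕ) : Measure ((ℕ → Finset (Fin k)) × (ℕ → ℕ)) :=
  (Measure.infinitePi (selMeasure L ε d x)).prod (Measure.infinitePi (sampleMeasure ε))

instance (x : ℕ → ℕ) : IsProbabilityMeasure (randomness L ε d x) := by
  unfold randomness
  infer_instance

/-- The private generator: the law of its output stream on the input stream `x`. -/
noncomputable def generator (x : ℕ → ℕ) : Measure (ℕ → ℕ) :=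
  (randomness L ε d x).map (generate L d)

variable {L ε d}

theorem measurable_generate : Measurable (generate L d) := by
  refine measurable_pi_iff.2 fun n => ?_
  have h : Measurable fun q : Finset (Fin k) × ℕ =>
      if d < n then Nat.nth (· ∈ Cl L q.1) q.2 else 0 := Measurable.of_discrete
  exact h.comp (f := fun p : (ℕ → Finset (Fin k)) × (ℕ → ℕ) =>
    (p.1 (Nat.log 2 (n - d)), p.2 n)) (by fun_prop)

instance (x : ℕ → ℕ) : IsProbabilityMeasure (generator L ε d x) :=
  Measure.isProbabilityMeasure_map measurable_generate.aemeasurable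

theorem selMeasure_congr {x x' : ℕ → ℕ} {r : ℕ} (h : ∀ t < d + 2 ^ r, x t = x' t) :
    selMeasure L ε d x r = selMeasure L ε d x' r := by
  have : selWeight L (ε / (2 * ((r + 1) * (r + 2)))) (2 ^ r / (2 * k)) (d + 2 ^ r) x =
      selWeight L (ε / (2 * ((r + 1) * (r + 2)))) (2 ^ r / (2 * k)) (d + 2 ^ r) x' := by
    funext S
    rw [selWeight, selWeight, errCount_congr h S]
  unfold selMeasure
  congr 2

theorem prefixCausal_generator : PrefixCausal (generator L ε d) := by
  classical
  intro x x' n h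
  let I : Finset ℕ := (Finset.range n).filter fun r => d + 2 ^ r < n
  let G : (I → Finset (Fin k)) × (ℕ → ℕ) → Fin n → ℕ := fun q m =>
    if d < m then Nat.nth
      (· ∈ Cl L (if hr : Nat.log 2 (m - d) ∈ I then q.1 ⟨_, hr⟩ else ∅)) (q.2 m) else 0
  have hG : Measurable G := by
    refine measurable_pi_iff.2 fun m => ?_
    have h1 : Measurable fun q : Finset (Fin k) × ℕ =>
        if d < m then Nat.nth (· ∈ Cl L q.1) q.2 else 0 := Measurable.of_discrete
    refine h1.comp (f := fun q : (I → Finset (Fin k)) × (ℕ → ℕ) =>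
      ((if hr : Nat.log 2 (m - d) ∈ I then q.1 ⟨_, hr⟩ else ∅ : Finset (Fin k)), q.2 m)) ?_
    refine Measurable.prodMk ?_ (by fun_prop)
    split_ifs
    · fun_prop
    · fun_prop
  have hfactor : (fun (w : ℕ → ℕ) (m : Fin n) => w m.val) ∘ generate L d =
      G ∘ Prod.map I.restrict id := by
    funext p m
    simp only [Function.comp_apply, generate, G, Prod.map_fst, Prod.map_snd, id]
    split_ifs with hd hI
    · rfl
    · refine absurd ?_ hI
      have h2 : 2 ^ Nat.log 2 (m.val - d) ≤ m.val - d := Nat.pow_log_le_self 2 (by omega)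
      have h3 : Nat.log 2 (m.val - d) < 2 ^ Nat.log 2 (m.val - d) := Nat.lt_two_pow_self
      have := m.isLt
      simp only [I, Finset.mem_filter, Finset.mem_range]
      omega
    · rfl
  have hrestrict : Measurable (fun (w : ℕ → ℕ) (m : Fin n) => w m.val) := by fun_prop
  have key : ∀ y : ℕ → ℕ, (generator L ε d y).map (fun (w : ℕ → ℕ) (m : Fin n) => w m.val) =
      ((Measure.pi fun r : I => selMeasure L ε d y r).prod
        (Measure.infinitePi (sampleMeasure ε))).map G := by
    intro y
    rw [generator, Measure.map_map hrestrict measurable_generate, hfactor,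
      ← Measure.map_map hG (by fun_prop), randomness,
      ← Measure.map_prod_map _ _ (by fun_prop) measurable_id, Measure.infinitePi_map_restrict,
      Measure.map_id]
  rw [key, key]
  have : (fun r : I => selMeasure L ε d x r) = fun r : I => selMeasure L ε d x' r := by
    funext r
    have hr := (Finset.mem_filter.1 r.2).2
    exact selMeasure_congr fun t ht => h t (ht.trans hr)
  rw [this]

theorem sum_budget_le (hε : 0 ≤ ε) (I : Finset ℕ) :
    ∑ r ∈ I, ε / ((r + 1) * (r + 2) : ℝ) ≤ ε := by
  have hrange : ∀ n : ℕ, ∑ r ∈ Finset.range n, ε / ((r + 1) * (r + 2) : ℝ) =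
      ε - ε / (n + 1) := by
    intro n
    induction n with
    | zero => simp
    | succ n ih =>
      rw [Finset.sum_range_succ, ih]
      push_cast
      field_simp
      ring
  obtain ⟨n, hn⟩ := I.exists_nat_subset_range
  refine (Finset.sum_le_sum_of_subset_of_nonneg hn fun r _ _ => by positivity).trans ?_
  rw [hrange]
  have : 0 ≤ ε / ((n : ℝ) + 1) := by positivity
  linarith

theorem dpcr_generator (hε : 0 ≤ ε) : DPCR ε (generator L ε d) := by
  intro x x' h E hE
  have hsel : ∀ r : ℕ, selMeasure L ε d x r ≤
      ENNReal.ofReal (Real.exp (ε / ((r + 1) * (r + 2)))) • selMeasure L ε d x' r := by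
    intro r
    have hη : 0 ≤ ε / (2 * ((r + 1) * (r + 2) : ℝ)) := by positivity
    have := proportionalPMF_le_smul (selWeight_nonneg (L := L) _ (2 ^ r / (2 * k)) (d + 2 ^ r) x)
      (sum_selWeight_pos _ _ _ x) (selWeight_nonneg _ _ _ x') (sum_selWeight_pos _ _ _ x')
      (Real.exp_pos _).le (selWeight_le_of_neighboring hη _ _ h)
      (selWeight_le_of_neighboring hη _ _ h.symm)
    have hb : ε / (2 * ((r + 1) * (r + 2) : ℝ)) + ε / (2 * ((r + 1) * (r + 2))) =
        ε / ((r + 1) * (r + 2)) := by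
      field_simp
      norm_num
    rw [← Real.exp_add, hb] at this
    exact this
  have hinf : Measure.infinitePi (selMeasure L ε d x) ≤
      ENNReal.ofReal (Real.exp ε) • Measure.infinitePi (selMeasure L ε d x') := by
    refine infinitePi_le_smul_infinitePi ENNReal.ofReal_ne_top hsel fun I => ?_
    rw [← ENNReal.ofReal_prod_of_nonneg fun r _ => (Real.exp_pos _).le, ← Real.exp_sum]
    exact ENNReal.ofReal_le_ofReal (Real.exp_le_exp.2 (sum_budget_le hε I))
  rw [generator, generator, Measure.map_apply measurable_generate hE,
    Measure.map_apply measurable_generate hE, randomness, randomness]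
  have := Measure.prod_mono hinf (le_refl (Measure.infinitePi (sampleMeasure ε)))
    (generate L d ⁻¹' E)
  rwa [Measure.prod_smul_left, Measure.smul_apply, smul_eq_mul] at this

theorem selMeasure_compl_le (hk : 0 < k) (hε : 0 ≤ ε) (hd : IsClosureBound L (d : ℤ))
    {x : ℕ → ℕ} (hx : Function.Injective x) {i : Fin k} (hi : (L i).Infinite)
    (hxi : ∀ t, x t ∈ L i) (r : ℕ) :
    selMeasure L ε d x r {S | i ∈ S ∧ (Cl L S).Infinite}ᶜ ≤
      ENNReal.ofReal (3 * Real.exp (-(ε * 2 ^ r / (4 * k * ((r + 1) * (r + 2)))))) := by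
  classical
  have hk' : (0 : ℝ) < k := by exact_mod_cast hk
  have hsum := sum_selWeight_notMem_le hd (x := x) (T := 2 ^ r) (hx.injOn) hi (fun t _ => hxi t)
    (η := ε / (2 * ((r + 1) * (r + 2)))) (β := 2 ^ r / (2 * k)) (by positivity) (by positivity)
    (by push_cast; field_simp)
  have hz : ε / (2 * ((r + 1) * (r + 2))) * (2 ^ r / (2 * k) : ℝ) =
      ε * 2 ^ r / (4 * k * ((r + 1) * (r + 2))) := by
    field_simp
    norm_num
  rw [hz] at hsum
  set q := Real.exp (-(ε * 2 ^ r / (4 * k * ((r + 1) * (r + 2))))) with hq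
  have hq0 : 0 < q := Real.exp_pos _
  by_cases hq1 : 1 ≤ 2 * q
  · refine prob_le_one.trans (ENNReal.one_le_ofReal.2 ?_)
    linarith
  have hpow : (2 * q) ^ k ≤ 2 * q := pow_le_of_le_one (by positivity) (by linarith) hk.ne'
  let B : Finset (Finset (Fin k)) := Finset.univ.filter fun S => ¬ (i ∈ S ∧ (Cl L S).Infinite)
  have hB : {S | i ∈ S ∧ (Cl L S).Infinite}ᶜ = (B : Set (Finset (Fin k))) := by
    ext S
    simp [B]
  rw [hB]
  refine proportionalPMF_toMeasure_le _ _ B ((?_ : _ ≤ _).trans (hsum.trans ?_))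
  · rw [Finset.sum_filter, Finset.sum_filter]
    refine Finset.sum_le_sum fun S _ => ?_
    by_cases hS : (Cl L S).Infinite
    · simp [hS]
    · simp [hS, selWeight]
  · have := (sum_selWeight_pos (L := L) (ε / (2 * ((r + 1) * (r + 2)))) (2 ^ r / (2 * k))
      (d + 2 ^ r) x).le
    gcongr
    linarith

theorem sampleMeasure_mem_le {f : ℕ → ℕ} (hf : Function.Injective f) {n : ℕ} {F : Finset ℕ}
    (hF : F.card ≤ n + 1) :
    sampleMeasure ε n {u | f u ∈ F} ≤ ENNReal.ofReal (Real.exp (-(ε * n))) * 2⁻¹ ^ (n + 1) := by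
  classical
  rw [sampleMeasure, PMF.toMeasure_uniformOfFinset_apply _ _ MeasurableSet.of_discrete,
    Finset.card_range]
  have hcard : ((Finset.range (sampleSize ε n)).filter fun u => u ∈ {u | f u ∈ F}).card ≤
      n + 1 := by
    refine (Finset.card_le_card_of_injOn f (fun u hu => ?_) hf.injOn).trans hF
    exact (Finset.mem_filter.1 hu).2
  have hE : ENNReal.ofReal (Real.exp (-(ε * n))) = (ENNReal.ofReal (Real.exp (ε * n)))⁻¹ := by
    rw [Real.exp_neg, ENNReal.ofReal_inv_of_pos (Real.exp_pos _)]
  have hsize : ((n + 1 : ℕ) : ℝ≥0∞) * (ENNReal.ofReal (Real.exp (ε * n)) * 2 ^ (n + 1)) ≤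
      sampleSize ε n := by
    have h1 : ENNReal.ofReal (Real.exp (ε * n)) ≤ (⌈Real.exp (ε * n)⌉₊ : ℝ≥0∞) := by
      rw [← ENNReal.ofReal_natCast]
      exact ENNReal.ofReal_le_ofReal (Nat.le_ceil _)
    unfold sampleSize
    push_cast
    rw [mul_assoc]
    gcongr (_ * ?_)
    rw [mul_comm]
    gcongr
  have hn0 : ((n + 1 : ℕ) : ℝ≥0∞) ≠ 0 := by simp
  calc _ ≤ ((n + 1 : ℕ) : ℝ≥0∞) / (((n + 1 : ℕ) : ℝ≥0∞) *
          (ENNReal.ofReal (Real.exp (ε * n)) * 2 ^ (n + 1))) :=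
        ENNReal.div_le_div (Nat.cast_le.2 (by convert hcard)) hsize
    _ = (ENNReal.ofReal (Real.exp (ε * n)) * 2 ^ (n + 1))⁻¹ := by
        rw [ENNReal.div_eq_inv_mul, ENNReal.mul_inv (Or.inl hn0) (Or.inl (by simp)),
          mul_right_comm, ENNReal.inv_mul_cancel hn0 (by simp), one_mul]
    _ = _ := by
        rw [ENNReal.mul_inv (Or.inr (by finiteness)) (Or.inl ENNReal.ofReal_ne_top), hE,
          ENNReal.inv_pow]

/-- Union bound: the generator fails after step `m` only if some later selection is bad or some
later sample was already seen. -/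
theorem one_le_generator_add_tsum (x : ℕ → ℕ) (i : Fin k) {m : ℕ} (hm : d < m) :
    1 ≤ generator L ε d x {w | ∀ n ≥ m, w n ∈ L i ∧ ∀ j ≤ n, w n ≠ x j} +
      (∑' j : ℕ, selMeasure L ε d x (Nat.log 2 (m - d) + j) {S | i ∈ S ∧ (Cl L S).Infinite}ᶜ +
        ∑' j : ℕ, ENNReal.ofReal (Real.exp (-(ε * (m + j : ℕ)))) * 2⁻¹ ^ (m + j + 1)) := by
  classical
  set good : Set (ℕ → ℕ) := {w | ∀ n ≥ m, w n ∈ L i ∧ ∀ j ≤ n, w n ≠ x j}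
  let B : ℕ → Set ((ℕ → Finset (Fin k)) × (ℕ → ℕ)) := fun j =>
    {p | p.1 (Nat.log 2 (m - d) + j) ∈ {S | i ∈ S ∧ (Cl L S).Infinite}ᶜ}
  let K : ℕ → Set ((ℕ → Finset (Fin k)) × (ℕ → ℕ)) := fun j =>
    {p | (Cl L (p.1 (Nat.log 2 (m + j - d)))).Infinite ∧
      Nat.nth (· ∈ Cl L (p.1 (Nat.log 2 (m + j - d)))) (p.2 (m + j)) ∈
        (Finset.range (m + j + 1)).image x}
  have hcover : (Set.univ : Set ((ℕ → Finset (Fin k)) × (ℕ → ℕ))) ⊆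
      generate L d ⁻¹' good ∪ ((⋃ j, B j) ∪ ⋃ j, K j) := by
    intro p _
    by_contra hp
    simp only [Set.mem_union, Set.mem_iUnion, not_or, not_exists] at hp
    obtain ⟨hpg, hpB, hpK⟩ := hp
    refine hpg fun n hn => ?_
    have hr : Nat.log 2 (m - d) ≤ Nat.log 2 (n - d) := Nat.log_mono_right (by omega)
    have hB := hpB (Nat.log 2 (n - d) - Nat.log 2 (m - d))
    have hK := hpK (n - m)
    simp only [B, Set.mem_ofPred_eq, Set.mem_compl_iff, not_not, Nat.add_sub_cancel' hr] at hB
    simp only [K, Set.mem_ofPred_eq, Nat.add_sub_cancel' hn, not_and] at hK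
    have hgen : generate L d p n = Nat.nth (· ∈ Cl L (p.1 (Nat.log 2 (n - d)))) (p.2 n) :=
      if_pos (by omega)
    rw [hgen]
    refine ⟨mem_Cl.1 (Nat.nth_mem_of_infinite hB.2 (p.2 n)) i hB.1, fun j hj h => hK hB.2 ?_⟩
    rw [h]
    exact Finset.mem_image_of_mem x (Finset.mem_range.2 (by omega))
  have hBle : ∀ j, randomness L ε d x (B j) ≤ selMeasure L ε d x (Nat.log 2 (m - d) + j)
      {S | i ∈ S ∧ (Cl L S).Infinite}ᶜ := by
    intro j
    have hset : B j = (Function.eval (Nat.log 2 (m - d) + j) ⁻¹'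
        {S | i ∈ S ∧ (Cl L S).Infinite}ᶜ) ×ˢ Set.univ := by
      ext p
      simp [B]
    rw [hset, randomness, Measure.prod_prod, measure_univ, mul_one,
      ← Measure.map_apply (by fun_prop) MeasurableSet.of_discrete, Measure.infinitePi_map_eval]
  have hKle : ∀ j, randomness L ε d x (K j) ≤
      ENNReal.ofReal (Real.exp (-(ε * (m + j : ℕ)))) * 2⁻¹ ^ (m + j + 1) := by
    intro j
    have hmeas : MeasurableSet (K j) := by
      have h : MeasurableSet {q : Finset (Fin k) × ℕ | (Cl L q.1).Infinite ∧
          Nat.nth (· ∈ Cl L q.1) q.2 ∈ (Finset.range (m + j + 1)).image x} :=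
        MeasurableSet.of_discrete
      exact h.preimage (f := fun p : (ℕ → Finset (Fin k)) × (ℕ → ℕ) =>
        (p.1 (Nat.log 2 (m + j - d)), p.2 (m + j))) (by fun_prop)
    rw [randomness, Measure.prod_apply hmeas]
    refine (lintegral_mono (g := fun _ => ENNReal.ofReal (Real.exp (-(ε * (m + j : ℕ)))) *
      2⁻¹ ^ (m + j + 1)) fun s => ?_).trans ?_
    · by_cases hs : (Cl L (s (Nat.log 2 (m + j - d)))).Infinite
      · have hslice : Prod.mk s ⁻¹' K j = Function.eval (m + j) ⁻¹'
            {u | Nat.nth (· ∈ Cl L (s (Nat.log 2 (m + j - d)))) u ∈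
              (Finset.range (m + j + 1)).image x} := by
          ext u
          simp [K, hs]
        rw [hslice, ← Measure.map_apply (by fun_prop) MeasurableSet.of_discrete,
          Measure.infinitePi_map_eval]
        exact sampleMeasure_mem_le (Nat.nth_injective hs)
          (Finset.card_image_le.trans_eq (Finset.card_range _))
      · have hslice : Prod.mk s ⁻¹' K j = ∅ := by
          ext u
          simp [K, hs]
        rw [hslice, measure_empty]
        exact zero_le
    · rw [lintegral_const, measure_univ, mul_one]
  calc 1 = randomness L ε d x Set.univ := measure_univ.symm
    _ ≤ randomness L ε d x (generate L d ⁻¹' good) +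
        (randomness L ε d x (⋃ j, B j) + randomness L ε d x (⋃ j, K j)) :=
        (measure_mono hcover).trans ((measure_union_le _ _).trans
          (by gcongr; exact measure_union_le _ _))
    _ ≤ _ := by
        gcongr
        · exact Measure.le_map_apply measurable_generate.aemeasurable _
        · exact (measure_iUnion_le _).trans (ENNReal.tsum_le_tsum hBle)
        · exact (measure_iUnion_le _).trans (ENNReal.tsum_le_tsum hKle)

theorem round_exponent_growth {a : ℝ} (ha : 0 ≤ a) (r j : ℕ) :
    a * 2 ^ r / (((r : ℝ) + 1) * (r + 2)) / 8 * (1 + j) ≤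
      a * 2 ^ (r + j) / ((((r + j : ℕ) : ℝ) + 1) * ((r + j : ℕ) + 2)) := by
  have hpow : ∀ j : ℕ, (1 + (j : ℝ)) ^ 3 ≤ 8 * 2 ^ j := by
    intro j
    induction j with
    | zero => norm_num
    | succ j ih =>
      rcases Nat.lt_or_ge j 3 with hj | hj
      · interval_cases j <;> norm_num
      · have hj' : (3 : ℝ) ≤ j := by exact_mod_cast hj
        calc (1 + ((j + 1 : ℕ) : ℝ)) ^ 3 ≤ 2 * (1 + (j : ℝ)) ^ 3 := by
              obtain ⟨t, ht⟩ : ∃ t : ℝ, t = j - 3 := ⟨_, rfl⟩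
              have ht0 : 0 ≤ t := by linarith
              have htj : (j : ℝ) = t + 3 := by linarith
              push_cast
              rw [htj]
              nlinarith [pow_nonneg ht0 2, pow_nonneg ht0 3]
          _ ≤ 8 * 2 ^ (j + 1) := by
              rw [pow_succ 2 j]
              linarith
  push_cast
  rw [div_div, div_mul_eq_mul_div, div_le_div_iff₀ (by positivity) (by positivity), pow_add]
  have h1 : (r + j + 1 : ℝ) ≤ (r + 1) * (1 + j) := by
    nlinarith [mul_nonneg r.cast_nonneg (j.cast_nonneg : (0 : ℝ) ≤ j)]
  have h2 : (r + j + 2 : ℝ) ≤ (r + 2) * (1 + j) := by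
    nlinarith [mul_nonneg r.cast_nonneg (j.cast_nonneg : (0 : ℝ) ≤ j),
      (j.cast_nonneg : (0 : ℝ) ≤ j)]
  calc a * 2 ^ r * (1 + j) * ((r + j + 1) * (r + j + 2))
      ≤ a * 2 ^ r * (1 + j) * (((r + 1) * (1 + j)) * ((r + 2) * (1 + j))) := by gcongr
    _ = a * 2 ^ r * ((r + 1) * (r + 2)) * (1 + j) ^ 3 := by ring
    _ ≤ a * 2 ^ r * ((r + 1) * (r + 2)) * (8 * 2 ^ j) := by
        gcongr
        exact hpow j
    _ = _ := by ring

theorem rate_le_round_exponent {T : ℕ} (hT : 2 ≤ T) :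
    1 / 2000 * (T : ℝ) / Real.log T ^ 2 ≤
      2 ^ Nat.log 2 T / (4 * (((Nat.log 2 T : ℕ) + 1) * ((Nat.log 2 T : ℕ) + 2))) / 8 := by
  set r := Nat.log 2 T with hr
  have hr1 : (1 : ℝ) ≤ r := by exact_mod_cast Nat.log_pos one_lt_two hT
  have hle : (2 : ℝ) ^ r ≤ T := by exact_mod_cast Nat.pow_log_le_self 2 (by omega)
  have hlt : (T : ℝ) ≤ 2 ^ r * 2 := by
    have := (Nat.lt_pow_succ_log_self one_lt_two T).le
    rw [pow_succ] at this
    exact_mod_cast this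
  have hlog : r * (1 / 2 : ℝ) ≤ Real.log T := by
    calc r * (1 / 2 : ℝ) ≤ r * Real.log 2 := by
          gcongr
          linarith [Real.log_two_gt_d9]
      _ = Real.log (2 ^ r) := (Real.log_pow 2 r).symm
      _ ≤ Real.log T := Real.log_le_log (by positivity) hle
  calc 1 / 2000 * (T : ℝ) / Real.log T ^ 2
      ≤ 1 / 2000 * (2 ^ r * 2) / (r * (1 / 2)) ^ 2 := by gcongr
    _ ≤ _ := by
        rw [div_div, div_le_div_iff₀ (by positivity) (by positivity)]
        have : ((r : ℝ) + 1) * (r + 2) ≤ 6 * r ^ 2 := by nlinarith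
        have h2 : (0 : ℝ) < 2 ^ r := by positivity
        nlinarith [mul_le_mul_of_nonneg_left this h2.le, mul_nonneg h2.le (sq_nonneg (r : ℝ))]

theorem tsum_sampleMeasure_bound_le (hε : 0 ≤ ε) (m : ℕ) :
    ∑' j : ℕ, ENNReal.ofReal (Real.exp (-(ε * (m + j : ℕ)))) * 2⁻¹ ^ (m + j + 1) ≤
      ENNReal.ofReal (2 * Real.exp (-(ε * m))) := by
  calc ∑' j : ℕ, ENNReal.ofReal (Real.exp (-(ε * (m + j : ℕ)))) * 2⁻¹ ^ (m + j + 1)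
      ≤ ∑' j : ℕ, ENNReal.ofReal (Real.exp (-(ε * m))) * 2⁻¹ ^ j := by
        refine ENNReal.tsum_le_tsum fun j => ?_
        refine mul_le_mul' (ENNReal.ofReal_le_ofReal (Real.exp_le_exp.2 ?_))
          (pow_le_pow_right_of_le_one' (by simp) (by omega))
        push_cast
        nlinarith [mul_nonneg hε (j.cast_nonneg : (0 : ℝ) ≤ j)]
    _ = ENNReal.ofReal (2 * Real.exp (-(ε * m))) := by
        rw [ENNReal.tsum_mul_left, ENNReal.tsum_geometric, ENNReal.one_sub_inv_two, inv_inv,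
          mul_comm, ENNReal.ofReal_mul zero_le_two, ENNReal.ofReal_ofNat]

theorem tsum_selMeasure_compl_le (hk : 0 < k) (hε : 0 ≤ ε) (hd : IsClosureBound L (d : ℤ))
    {x : ℕ → ℕ} (hx : Function.Injective x) {i : Fin k} (hi : (L i).Infinite)
    (hxi : ∀ t, x t ∈ L i) (r : ℕ) {y : ℝ}
    (hy : y = ε / (4 * k) * 2 ^ r / (((r : ℝ) + 1) * (r + 2)) / 8)
    (hy2 : 2 * Real.exp (-y) ≤ 1) :
    ∑' j : ℕ, selMeasure L ε d x (r + j) {S | i ∈ S ∧ (Cl L S).Infinite}ᶜ ≤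
      ENNReal.ofReal (6 * Real.exp (-y)) := by
  calc ∑' j : ℕ, selMeasure L ε d x (r + j) {S | i ∈ S ∧ (Cl L S).Infinite}ᶜ
      ≤ ∑' j : ℕ, ENNReal.ofReal (3 * Real.exp (-y)) * 2⁻¹ ^ j := by
        refine ENNReal.tsum_le_tsum fun j => ?_
        have hhalf : (2⁻¹ : ℝ≥0∞) ^ j = ENNReal.ofReal ((1 / 2) ^ j) := by
          rw [ENNReal.ofReal_pow (by norm_num), one_div, ENNReal.ofReal_inv_of_pos two_pos,
            ENNReal.ofReal_ofNat]
        rw [hhalf, ← ENNReal.ofReal_mul (p := 3 * Real.exp (-y)) (by positivity)]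
        refine (selMeasure_compl_le hk hε hd hx hi hxi (r + j)).trans
          (ENNReal.ofReal_le_ofReal ?_)
        rw [mul_assoc 3 (Real.exp (-y))]
        refine mul_le_mul_of_nonneg_left ?_ (by norm_num : (0 : ℝ) ≤ 3)
        have hgrow := round_exponent_growth (a := ε / (4 * k)) (by positivity) r j
        rw [← hy] at hgrow
        calc Real.exp (-(ε * 2 ^ (r + j) /
              (4 * k * ((((r + j : ℕ) : ℝ) + 1) * ((r + j : ℕ) + 2)))))
            ≤ Real.exp (-y + j * -y) := by
              refine Real.exp_le_exp.2 ?_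
              rw [div_mul_eq_mul_div, div_div] at hgrow
              linarith
          _ = Real.exp (-y) * Real.exp (-y) ^ j := by rw [Real.exp_add, Real.exp_nat_mul]
          _ ≤ Real.exp (-y) * (1 / 2) ^ j := by
              gcongr
              linarith
    _ = ENNReal.ofReal (6 * Real.exp (-y)) := by
        rw [ENNReal.tsum_mul_left, ENNReal.tsum_geometric, ENNReal.one_sub_inv_two, inv_inv,
          mul_comm, ← ENNReal.ofReal_ofNat 2, ← ENNReal.ofReal_mul zero_le_two]
        congr 1
        ring

theorem generator_correct (hk : 0 < k) (hε : 0 ≤ ε) (hd : IsClosureBound L (d : ℤ))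
    {x : ℕ → ℕ} (hx : Function.Injective x) {i : Fin k} (hi : (L i).Infinite)
    (hxi : ∀ t, x t ∈ L i) {m : ℕ} (hm : d + 2 ≤ m) :
    ENNReal.ofReal (1 - 8 * Real.exp (-(1 / 2000 * ε * ((m : ℝ) - (d : ℝ))) /
        (k * (Real.log ((m : ℝ) - (d : ℝ))) ^ 2))) ≤
      generator L ε d x {w | ∀ n ≥ m, w n ∈ L i ∧ ∀ j ≤ n, w n ≠ x j} := by
  obtain ⟨T, rfl⟩ : ∃ T, m = d + T := ⟨m - d, by omega⟩
  have hT : 2 ≤ T := by omega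
  have hT' : ((d + T : ℕ) : ℝ) - d = T := by push_cast; ring
  have hk' : (1 : ℝ) ≤ k := by exact_mod_cast hk
  set r := Nat.log 2 T with hr
  obtain ⟨y, hy⟩ : ∃ y, y = ε / (4 * k) * 2 ^ r / (((r : ℝ) + 1) * (r + 2)) / 8 := ⟨_, rfl⟩
  set X := 1 / 2000 * ε * (T : ℝ) / (k * Real.log T ^ 2) with hX
  have hXy : X ≤ y := by
    calc X = ε / k * (1 / 2000 * (T : ℝ) / Real.log T ^ 2) := by
          rw [hX, div_mul_div_comm]
          ring
      _ ≤ ε / k * (2 ^ r / (4 * (((r : ℕ) + 1) * ((r : ℕ) + 2))) / 8) :=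
          mul_le_mul_of_nonneg_left (rate_le_round_exponent hT) (by positivity)
      _ = y := by
          rw [hy]
          field_simp
  have hXm : X ≤ ε * (d + T : ℕ) := by
    have hlog : 1 / 2 ≤ Real.log T := by
      have := Real.log_le_log two_pos (by exact_mod_cast hT : (2 : ℝ) ≤ T)
      linarith [Real.log_two_gt_d9]
    have hden : 1 / 4 ≤ k * Real.log T ^ 2 := by nlinarith
    rw [hX, div_le_iff₀ (by linarith)]
    have hεT : 0 ≤ ε * T := by positivity
    have hεd : 0 ≤ ε * d := by positivity
    push_cast
    nlinarith
  rw [hT', neg_div]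
  have hexp : Real.exp (-y) ≤ Real.exp (-X) := Real.exp_le_exp.2 (by linarith)
  have hexp' : Real.exp (-(ε * (d + T : ℕ))) ≤ Real.exp (-X) := Real.exp_le_exp.2 (by linarith)
  by_cases hy2 : 2 * Real.exp (-y) ≤ 1
  swap
  · rw [ENNReal.ofReal_of_nonpos (by linarith)]
    exact zero_le
  have hunion := one_le_generator_add_tsum (L := L) (ε := ε) x i (show d < d + T by omega)
  rw [Nat.add_sub_cancel_left] at hunion
  rw [ENNReal.ofReal_sub _ (by positivity), ENNReal.ofReal_one, tsub_le_iff_right]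
  refine hunion.trans (add_le_add_right ?_ _)
  refine (add_le_add (tsum_selMeasure_compl_le hk hε hd hx hi hxi r hy hy2)
    (tsum_sampleMeasure_bound_le hε _)).trans ?_
  rw [← ENNReal.ofReal_add (by positivity) (by positivity)]
  exact ENNReal.ofReal_le_ofReal (by linarith)

end Generator

/-- There are absolute constants C, c > 0 such that every finite
collection of `k` infinite languages with closure dimension `d` admits a
prefix-causal ε-DP continual-release generator which, on any duplicate-free
enumeration of a target language, generates correctly from every step `n ≥ m`
onward with probability at least
`1 − C·exp(−c·ε·(m−d)/(k·(log(m−d))²))`, for every integer `m ≥ d + 2`. -/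
theorem stmt3 :
    ∃ C > (0 : ℝ), ∃ c > (0 : ℝ),
      ∀ (k : ℕ), 0 < k → ∀ (L : Fin k → Set ℕ), (∀ i, (L i).Infinite) →
      ∀ (d : ℕ), HasClosureDim L (d : ℤ) → ∀ ε : ℝ, 0 < ε →
      ∃ A : (ℕ → ℕ) → MeasureTheory.Measure (ℕ → ℕ),
        (∀ x, MeasureTheory.IsProbabilityMeasure (A x)) ∧ PrefixCausal A ∧ DPCR ε A ∧
        ∀ i : Fin k, ∀ e : ℕ → ℕ, Function.Injective e → Set.range e = L i →
          ∀ m : ℕ, d + 2 ≤ m →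
            ENNReal.ofReal
                (1 - C * Real.exp (-(c * ε * ((m : ℝ) - (d : ℝ))) /
                  (k * (Real.log ((m : ℝ) - (d : ℝ)))^2))) ≤
              A e {w | ∀ n ≥ m, w n ∈ L i ∧ ∀ j ≤ n, w n ≠ e j} := by
  refine ⟨8, by norm_num, 1 / 2000, by norm_num, fun k hk L hL d hd ε hε =>
    ⟨generator L ε d, fun x => inferInstance, prefixCausal_generator, dpcr_generator hε.le,
      fun i e he hrange m hm => generator_correct hk hε.le hd.1 he (hL i) (fun t => ?_) hm⟩⟩
  exact hrange ▸ Set.mem_range_self t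
end

section
/- Let N ≥ 1 and let P_1, …, P_N be pairwise disjoint infinite subsets of ℕ. Let ε > 0 and n ∈ ℕ, and let A : (Fin n → ℕ) → PMF(ℕ) be an ε-differentially private algorithm such that for every j ∈ {1,…,N} and every injective input y : Fin n → ℕ with range contained in P_j, the probability that A(y) outputs an element of P_j is at least 2/3. Then exp(n·ε) ≥ (2/3)·N. -/
/-- Group privacy: if two inputs agree outside `s`, the output probabilities of an
`ε`-differentially private algorithm are within a factor `exp(ε) ^ #s`. -/
theorem DPFin.le_pow_card_mul {n : ℕ} {α Y : Type*} {ε : ℝ} (hε : 0 ≤ ε)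
    {A : (Fin n → α) → PMF Y} (hDP : DPFin ε A) (E : Set Y) (s : Finset (Fin n)) :
    ∀ x x' : Fin n → α, (∀ i, i ∉ s → x i = x' i) →
      (A x).toOuterMeasure E ≤
        ENNReal.ofReal (Real.exp ε) ^ s.card * (A x').toOuterMeasure E := by
  induction s using Finset.induction_on with
  | empty =>
    intro x x' h
    obtain rfl : x = x' := funext fun i => h i (Finset.notMem_empty i)
    simp
  | insert a s ha ih =>
    intro x x' h
    have hstep : (A x).toOuterMeasure E ≤ ENNReal.ofReal (Real.exp ε) *
        (A (Function.update x a (x' a))).toOuterMeasure E := by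
      by_cases hxa : x a = x' a
      · rw [← hxa, Function.update_eq_self]
        refine le_mul_of_one_le_left' ?_
        rw [ENNReal.one_le_ofReal]
        exact Real.one_le_exp hε
      · refine hDP _ _ ⟨a, by simpa using hxa, fun m hm => ?_⟩ E
        rw [Function.update_of_ne hm]
    have hrest := ih (Function.update x a (x' a)) x' fun i hi => by
      by_cases hia : i = a
      · subst hia; simp
      · rw [Function.update_of_ne hia]
        exact h i (by simp [hia, hi])
    rw [Finset.card_insert_of_notMem ha, pow_succ', mul_assoc]
    exact hstep.trans (by gcongr)

/-- The probabilities of finitely many pairwise disjoint events sum to at most one. -/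
theorem PMF.sum_toOuterMeasure_le_one {α ι : Type*} [Fintype ι] (p : PMF α) (P : ι → Set α)
    (hP : Pairwise (Function.onFun Disjoint P)) :
    ∑ j, p.toOuterMeasure (P j) ≤ 1 := by
  let _ : MeasurableSpace α := ⊤
  have hm (s : Set α) : p.toOuterMeasure s = p.toMeasure s :=
    (p.toMeasure_apply_eq_toOuterMeasure_apply MeasurableSpace.measurableSet_top).symm
  simp only [hm]
  rw [← tsum_fintype (L := .unconditional _),
    ← MeasureTheory.measure_iUnion hP fun _ => MeasurableSpace.measurableSet_top]
  exact MeasureTheory.prob_le_one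

/-- packing lower bound: If `P_1, …, P_N` are pairwise disjoint
infinite subsets of ℕ and an ε-DP algorithm on `n` inputs outputs an element of
`P_j` with probability at least 2/3 whenever its input consists of distinct
elements of `P_j`, then `exp(n·ε) ≥ (2/3)·N`. -/
theorem stmt6 (N : ℕ) (hN : 1 ≤ N) (P : Fin N → Set ℕ) (hInf : ∀ j, (P j).Infinite)
    (hDisj : ∀ j j' : Fin N, j ≠ j' → Disjoint (P j) (P j'))
    (ε : ℝ) (hε : 0 < ε) (n : ℕ)
    (A : (Fin n → ℕ) → PMF ℕ) (hDP : DPFin ε A)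
    (hGen : ∀ j : Fin N, ∀ y : Fin n → ℕ, Function.Injective y →
      Set.range y ⊆ P j → ENNReal.ofReal (2 / 3) ≤ (A y).toOuterMeasure (P j)) :
    (2 / 3 : ℝ) * (N : ℝ) ≤ Real.exp ((n : ℝ) * ε) := by
  have hy (j : Fin N) : ∃ y : Fin n → ℕ, Function.Injective y ∧ Set.range y ⊆ P j := by
    let f := (hInf j).natEmbedding
    refine ⟨fun i => f i, fun a b hab => Fin.ext (f.injective (Subtype.ext hab)), ?_⟩
    rintro _ ⟨i, rfl⟩
    exact (f i).2
  choose y hyinj hyran using hy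
  have hbound (j : Fin N) : ENNReal.ofReal (2 / 3) ≤
      ENNReal.ofReal (Real.exp ε) ^ n * (A 0).toOuterMeasure (P j) := by
    simpa using (hGen j (y j) (hyinj j) (hyran j)).trans
      (hDP.le_pow_card_mul hε.le (P j) Finset.univ (y j) 0 (by simp))
  have hsum : ∑ _j : Fin N, ENNReal.ofReal (2 / 3) ≤ ENNReal.ofReal (Real.exp ε) ^ n :=
    calc ∑ _j : Fin N, ENNReal.ofReal (2 / 3)
        ≤ ∑ j, ENNReal.ofReal (Real.exp ε) ^ n * (A 0).toOuterMeasure (P j) :=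
          Finset.sum_le_sum fun j _ => hbound j
      _ = ENNReal.ofReal (Real.exp ε) ^ n * ∑ j, (A 0).toOuterMeasure (P j) := by
          rw [Finset.mul_sum]
      _ ≤ ENNReal.ofReal (Real.exp ε) ^ n :=
          mul_le_of_le_one_right' ((A 0).sum_toOuterMeasure_le_one P fun i j h => hDisj i j h)
  rw [← ENNReal.ofReal_sum_of_nonneg fun _ _ => by norm_num,
    ← ENNReal.ofReal_pow (Real.exp_pos ε).le, ← Real.exp_nat_mul,
    ENNReal.ofReal_le_ofReal_iff (Real.exp_pos _).le] at hsum
  simpa [mul_comm] using hsum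
end

section
/- Let k ≥ 2 and let 𝓛 = {L_1, …, L_k} be the Sperner collection. Then there exists a deterministic family of maps G_n : (Fin n → ℕ) → ℕ (n ≥ 1) such that for every i ∈ {1,…,k}, every enumeration e of L_i, and every n ≥ 1, the output G_n(e(0), …, e(n−1)) lies in L_i \ {e(0), …, e(n−1)}; that is, without privacy constraints a single input element suffices for uniform generation from the Sperner collection. -/
/-- The Sperner collection: `L i = { j + N·t : j ∈ {1,…,N}, i ∈ S_j, t ∈ ℕ }`,
where `S_1, …, S_N` enumerate the ⌊k/2⌋-element subsets of `{1,…,k}`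
(indices shifted to be 0-based: `S (j-1)` is `S_j` and the element `j + N·t`
is written `(j : ℕ) + 1 + N * t` for `j : Fin N`). -/
def spernerLang (k N : ℕ) (S : Fin N → Finset (Fin k)) (i : Fin k) : Set ℕ :=
  {x | ∃ (j : Fin N) (t : ℕ), i ∈ S j ∧ x = (j : ℕ) + 1 + N * t}

/-- `S` is an enumeration of the ⌊k/2⌋-element subsets of `{1,…,k}`. -/
def IsSpernerEnum (k : ℕ) (S : Fin (k.choose (k / 2)) → Finset (Fin k)) : Prop :=
  Function.Injective S ∧ (∀ j, (S j).card = k / 2) ∧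
    ∀ T : Finset (Fin k), T.card = k / 2 → ∃ j, S j = T

/-- Without privacy constraints, a single input element suffices
for uniform generation from the Sperner collection: there is a deterministic
family of maps `G n` which, on the first `n ≥ 1` elements of any enumeration of
any language of the collection, outputs a valid unseen element. -/
theorem stmt7 (k : ℕ) (hk : 2 ≤ k) (S : Fin (k.choose (k / 2)) → Finset (Fin k))
    (hS : IsSpernerEnum k S) :
    ∃ G : (n : ℕ) → (Fin n → ℕ) → ℕ,
      ∀ i : Fin k, ∀ e : ℕ → ℕ,
        IsEnumeration (spernerLang k (k.choose (k / 2)) S i) e →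
        ∀ n : ℕ, 1 ≤ n →
          G n (fun m : Fin n => e m.val) ∈ spernerLang k (k.choose (k / 2)) S i ∧
          ∀ m' < n, G n (fun m : Fin n => e m.val) ≠ e m' := by
  have hN : 0 < k.choose (k / 2) := Nat.choose_pos (Nat.div_le_self k 2)
  refine ⟨fun n x => if h : 0 < n then x ⟨0, h⟩ + k.choose (k / 2) * (1 + ∑ m, x m) else 0, ?_⟩
  intro i e he n hn
  simp only [dif_pos (show 0 < n from hn)]
  constructor
  · obtain ⟨j, t, hj, ht⟩ := he.1 0
    refine ⟨j, t + (1 + ∑ m : Fin n, e m), hj, ?_⟩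
    rw [ht]
    ring
  · intro m hm
    have hsum : e m ≤ ∑ l : Fin n, e l :=
      Finset.single_le_sum (f := fun l : Fin n => e l) (fun _ _ => Nat.zero_le _)
        (Finset.mem_univ ⟨m, hm⟩)
    have hmul := Nat.le_mul_of_pos_left (1 + ∑ l : Fin n, e l) hN
    omega
end

section
/- Let k ≥ 2, let N = binom(k, ⌊k/2⌋), let S_1, …, S_N enumerate the ⌊k/2⌋-element subsets of {1,…,k}, and let 𝓛 = {L_1, …, L_k} be the Sperner collection. Then for every i ∈ {1,…,N}, the intersection ⋂_{ℓ ∈ S_i} L_ℓ equals the arithmetic progression { i + N·t : t ∈ ℕ }. -/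
/-- The number `j + 1 + N * t` lies in the language of `i` exactly when `i ∈ S j`. -/
theorem add_mul_mem_spernerLang {k N : ℕ} {S : Fin N → Finset (Fin k)} {i : Fin k}
    {j : Fin N} {t : ℕ} : (j : ℕ) + 1 + N * t ∈ spernerLang k N S i ↔ i ∈ S j := by
  refine ⟨?_, fun h => ⟨j, t, h, rfl⟩⟩
  rintro ⟨j', t', h, he⟩
  have hmod : (j + N * t) % N = (j' + N * t') % N := congrArg (· % N) (by omega)
  rw [Nat.add_mul_mod_self_left, Nat.add_mul_mod_self_left, Nat.mod_eq_of_lt j.isLt,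
    Nat.mod_eq_of_lt j'.isLt] at hmod
  rwa [Fin.ext hmod]

/-- For the Sperner collection, the intersection of the languages
indexed by `S_i` is exactly the arithmetic progression `{ i + N·t : t ∈ ℕ }`
(written 0-based: `(i : ℕ) + 1 + N·t` for `i : Fin N`). -/
theorem stmt8 (k : ℕ) (hk : 2 ≤ k) (S : Fin (k.choose (k / 2)) → Finset (Fin k))
    (hS : IsSpernerEnum k S) (i : Fin (k.choose (k / 2))) :
    (⋂ ℓ ∈ S i, spernerLang k (k.choose (k / 2)) S ℓ) =
      {x : ℕ | ∃ t : ℕ, x = (i : ℕ) + 1 + (k.choose (k / 2)) * t} := by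
  ext x
  simp only [Set.mem_iInter, Set.mem_ofPred_eq]
  constructor
  · intro hx
    have hpos : 0 < (S i).card := by
      rw [hS.2.1 i]
      omega
    obtain ⟨ℓ, hℓ⟩ := Finset.card_pos.mp hpos
    obtain ⟨j, t, -, rfl⟩ := hx ℓ hℓ
    have hsub : S i ⊆ S j := fun m hm => add_mul_mem_spernerLang.mp (hx m hm)
    have heq : S i = S j :=
      Finset.eq_of_subset_of_card_le hsub (by rw [hS.2.1 i, hS.2.1 j])
    exact ⟨t, by rw [hS.1 heq]⟩
  · rintro ⟨t, rfl⟩ ℓ hℓ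
    exact add_mul_mem_spernerLang.mpr hℓ
end

section
/- Let k ≥ 2 and let 𝓛 = {L_1, …, L_k} be the Sperner collection. Then for every nonempty subset T ⊆ {1,…,k}: if |T| ≤ ⌊k/2⌋ then ⋂_{ℓ ∈ T} L_ℓ is infinite, and if |T| > ⌊k/2⌋ then ⋂_{ℓ ∈ T} L_ℓ = ∅. In particular, the closure dimension of the Sperner collection equals 0. -/
theorem fin_eq_of_add_one_add_mul_eq {N : ℕ} {j j' : Fin N} {t t' : ℕ}
    (h : (j : ℕ) + 1 + N * t = (j' : ℕ) + 1 + N * t') : j = j' := by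
  have h' : (j : ℕ) + N * t = (j' : ℕ) + N * t' := by omega
  have hmod := congrArg (· % N) h'
  simp only [Nat.add_mul_mod_self_left, Nat.mod_eq_of_lt j.isLt,
    Nat.mod_eq_of_lt j'.isLt] at hmod
  exact Fin.ext hmod

theorem infinite_iInter_spernerLang {k N : ℕ} {S : Fin N → Finset (Fin k)}
    {T : Finset (Fin k)} {j : Fin N} (hT : T ⊆ S j) :
    (⋂ i ∈ T, spernerLang k N S i).Infinite := by
  have hinj : Function.Injective fun t : ℕ => (j : ℕ) + 1 + N * t := fun t t' h =>
    Nat.eq_of_mul_eq_mul_left j.pos (Nat.add_left_cancel h)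
  refine (Set.infinite_range_of_injective hinj).mono ?_
  rintro _ ⟨t, rfl⟩
  exact Set.mem_iInter₂.2 fun i hi => ⟨j, t, hT hi, rfl⟩

theorem exists_subset_of_mem_iInter_spernerLang {k N : ℕ} {S : Fin N → Finset (Fin k)}
    {T : Finset (Fin k)} (hT : T.Nonempty) {x : ℕ}
    (hx : x ∈ ⋂ i ∈ T, spernerLang k N S i) : ∃ j, T ⊆ S j := by
  rw [Set.mem_iInter₂] at hx
  obtain ⟨i₀, hi₀⟩ := hT
  obtain ⟨j, t, -, hj⟩ := hx i₀ hi₀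
  refine ⟨j, fun i hi => ?_⟩
  obtain ⟨j', t', hij', hj'⟩ := hx i hi
  rwa [fin_eq_of_add_one_add_mul_eq (hj.symm.trans hj')]

theorem IsSpernerEnum.exists_superset {k : ℕ}
    {S : Fin (k.choose (k / 2)) → Finset (Fin k)} (hS : IsSpernerEnum k S)
    {T : Finset (Fin k)} (hT : T.card ≤ k / 2) : ∃ j, T ⊆ S j := by
  obtain ⟨U, hTU, -, hU⟩ := Finset.exists_subsuperset_card_eq (Finset.subset_univ T) hT
    (by simpa using Nat.div_le_self k 2)
  obtain ⟨j, rfl⟩ := hS.2.2 U hU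
  exact ⟨j, hTU⟩

theorem IsSpernerEnum.iInter_eq_empty {k : ℕ}
    {S : Fin (k.choose (k / 2)) → Finset (Fin k)} (hS : IsSpernerEnum k S)
    {T : Finset (Fin k)} (hT : k / 2 < T.card) :
    (⋂ i ∈ T, spernerLang k (k.choose (k / 2)) S i) = ∅ := by
  refine Set.eq_empty_of_forall_notMem fun x hx => ?_
  obtain ⟨j, hj⟩ := exists_subset_of_mem_iInter_spernerLang
    (Finset.card_pos.1 (Nat.zero_lt_of_lt hT)) hx
  have := Finset.card_le_card hj
  rw [hS.2.1 j] at this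
  omega

/-- For the Sperner collection, every nonempty subcollection of at
most ⌊k/2⌋ languages has infinite intersection, every subcollection of more
than ⌊k/2⌋ languages has empty intersection, and the closure dimension of the
collection equals 0. -/
theorem stmt9 (k : ℕ) (hk : 2 ≤ k) (S : Fin (k.choose (k / 2)) → Finset (Fin k))
    (hS : IsSpernerEnum k S) :
    (∀ T : Finset (Fin k), T.Nonempty →
      (T.card ≤ k / 2 →
        (⋂ ℓ ∈ T, spernerLang k (k.choose (k / 2)) S ℓ).Infinite) ∧
      (k / 2 < T.card →
        (⋂ ℓ ∈ T, spernerLang k (k.choose (k / 2)) S ℓ) = ∅)) ∧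
    HasClosureDim (spernerLang k (k.choose (k / 2)) S) 0 := by
  have hinf : ∀ T : Finset (Fin k), T.card ≤ k / 2 →
      (⋂ ℓ ∈ T, spernerLang k (k.choose (k / 2)) S ℓ).Infinite := fun T hT =>
    let ⟨_, hj⟩ := hS.exists_superset hT
    infinite_iInter_spernerLang hj
  refine ⟨fun T _ => ⟨hinf T, hS.iInter_eq_empty⟩, fun T => ?_, fun d' _ hd' => ?_⟩
  · rcases le_or_gt T.card (k / 2) with hT | hT
    · exact Or.inl (hinf T hT)
    · exact Or.inr (by simp [Cl, hS.iInter_eq_empty hT])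
  · have hempty : Cl (spernerLang k (k.choose (k / 2)) S) Finset.univ = ∅ :=
      hS.iInter_eq_empty (by rw [Finset.card_univ, Fintype.card_fin]; omega)
    simpa [hempty] using hd' Finset.univ
end

section
/- There exists a countable collection 𝓛 = {L_i}_{i∈ℕ} of infinite subsets of ℕ×ℕ with closure dimension 0 such that for every ε > 0 and every n ∈ ℕ, no ε-differentially private algorithm A : (Fin n → ℕ×ℕ) → PMF(ℕ×ℕ) can generate uniformly with probability 2/3: for every such A there exist a language K ∈ 𝓛 and an injective input x : Fin n → ℕ×ℕ with range contained in K such that the probability that A(x) outputs an element of K \ range(x) is strictly less than 2/3. -/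
/-- The closure of a subcollection of a countable collection of languages over
the universe ℕ × ℕ: the intersection of the languages indexed by `T`
(with closure of the empty subcollection equal to `Set.univ`). -/
def ClC (L : ℕ → Set (ℕ × ℕ)) (T : Set ℕ) : Set (ℕ × ℕ) := ⋂ i ∈ T, L i

/-- `d` bounds the closure dimension of the countable collection `L`. -/
def IsClosureBoundC (L : ℕ → Set (ℕ × ℕ)) (d : ℤ) : Prop :=
  ∀ T : Set ℕ, (ClC L T).Infinite ∨ ((ClC L T).ncard : ℤ) ≤ d

/-- The closure dimension of `L` is the smallest `d ∈ {-1} ∪ ℕ` bounding it. -/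
def HasClosureDimC (L : ℕ → Set (ℕ × ℕ)) (d : ℤ) : Prop :=
  IsClosureBoundC L d ∧ ∀ d' : ℤ, -1 ≤ d' → IsClosureBoundC L d' → d ≤ d'

/-- Group privacy: inputs agreeing outside `s` have output laws within a factor `exp(ε) ^ #s`. -/
theorem DPFin.le_pow_mul {n : ℕ} {α Y : Type*} {ε : ℝ} {A : (Fin n → α) → PMF Y}
    (hε : 0 ≤ ε) (hA : DPFin ε A) (E : Set Y) (s : Finset (Fin n)) (x x' : Fin n → α)
    (h : ∀ j ∉ s, x j = x' j) :
    (A x).toOuterMeasure E ≤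
      ENNReal.ofReal (Real.exp ε) ^ s.card * (A x').toOuterMeasure E := by
  classical
  induction s using Finset.induction_on generalizing x with
  | empty =>
    obtain rfl : x = x' := funext fun j => h j (Finset.notMem_empty j)
    simp
  | insert a s ha ih =>
    have hstep : (A x).toOuterMeasure E ≤ ENNReal.ofReal (Real.exp ε) *
        (A (Function.update x a (x' a))).toOuterMeasure E := by
      by_cases hxa : x a = x' a
      · rw [← hxa, Function.update_eq_self]
        exact le_mul_of_one_le_left zero_le
          (ENNReal.one_le_ofReal.2 (Real.one_le_exp hε))
      · refine hA _ _ ⟨a, by simpa using hxa, fun m hm => ?_⟩ E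
        rw [Function.update_of_ne hm]
    have hrest := ih (Function.update x a (x' a)) fun j hj => by
      by_cases hja : j = a
      · subst hja
        simp
      · rw [Function.update_of_ne hja]
        exact h j (by simp [hja, hj])
    rw [Finset.card_insert_of_notMem ha, pow_succ', mul_assoc]
    exact hstep.trans (by gcongr)

/-- No positive constant bounds the masses of all the columns of a law on `ℕ × ℕ` from below. -/
theorem PMF.eq_zero_of_le_toOuterMeasure_fst_preimage (p : PMF (ℕ × ℕ)) (c : ENNReal)
    (h : ∀ i, c ≤ p.toOuterMeasure (Prod.fst ⁻¹' {i})) : c = 0 := by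
  by_contra hc
  have hle : ∑' _ : ℕ, c ≤ ∑' i, p.map Prod.fst i := by
    refine ENNReal.tsum_le_tsum fun i => ?_
    rw [← PMF.toOuterMeasure_apply_singleton, PMF.toOuterMeasure_map_apply]
    exact h i
  rw [ENNReal.tsum_const_eq_top_of_ne_zero hc, PMF.tsum_coe] at hle
  exact absurd hle (by simp)

/-- The columns of `ℕ × ℕ` form a collection of closure dimension zero. -/
theorem hasClosureDimC_fst_preimage :
    HasClosureDimC (fun i => Prod.fst ⁻¹' {i}) 0 := by
  constructor
  · intro T
    rcases T.subsingleton_or_nontrivial with hT | ⟨i, hi, j, hj, hij⟩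
    · left
      obtain ⟨i, hi⟩ : ∃ i, T ⊆ {i} := by
        rcases hT.eq_empty_or_singleton with rfl | ⟨i, rfl⟩
        · exact ⟨0, Set.empty_subset _⟩
        · exact ⟨i, subset_rfl⟩
      refine (Set.infinite_range_of_injective (Prod.mk_right_injective i)).mono ?_
      rintro _ ⟨m, rfl⟩
      simp only [ClC, Set.mem_iInter]
      intro k hk
      exact (hi hk).symm
    · right
      have hempty : ClC (fun i => Prod.fst ⁻¹' {i}) T = ∅ := by
        refine Set.eq_empty_of_forall_notMem fun q hq => hij ?_
        simp only [ClC, Set.mem_iInter] at hq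
        exact (hq i hi).symm.trans (hq j hj)
      simp [hempty]
  · intro d' _ hd'
    rcases hd' {0, 1} with h | h
    · refine absurd h (Set.not_infinite.2 ?_)
      convert Set.finite_empty
      refine Set.eq_empty_of_forall_notMem fun q hq => ?_
      simp only [ClC, Set.mem_iInter] at hq
      exact zero_ne_one ((hq 0 (by simp)).symm.trans (hq 1 (by simp)))
    · exact (Int.natCast_nonneg _).trans h

/-- There is a countable collection of infinite languages over
ℕ × ℕ with closure dimension 0 such that for every ε > 0 and every n, no ε-DP
algorithm on `n` inputs can generate uniformly with probability 2/3. -/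
theorem stmt10 :
    ∃ L : ℕ → Set (ℕ × ℕ), (∀ i, (L i).Infinite) ∧ HasClosureDimC L 0 ∧
      ∀ ε : ℝ, 0 < ε → ∀ n : ℕ, ∀ A : (Fin n → ℕ × ℕ) → PMF (ℕ × ℕ), DPFin ε A →
        ∃ (i : ℕ) (x : Fin n → ℕ × ℕ), Function.Injective x ∧
          Set.range x ⊆ L i ∧
          (A x).toOuterMeasure (L i \ Set.range x) < ENNReal.ofReal (2 / 3) := by
  refine ⟨fun i => Prod.fst ⁻¹' {i}, fun i => ?_, hasClosureDimC_fst_preimage, ?_⟩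
  · refine (Set.infinite_range_of_injective (Prod.mk_right_injective i)).mono ?_
    rintro _ ⟨m, rfl⟩
    rfl
  · intro ε hε n A hA
    by_contra! hgood
    let x : ℕ → Fin n → ℕ × ℕ := fun i j => (i, j)
    set C := ENNReal.ofReal (Real.exp ε) ^ n with hC
    have hCtop : C ≠ ⊤ := ENNReal.pow_ne_top ENNReal.ofReal_ne_top
    have hmass (i : ℕ) :
        ENNReal.ofReal (2 / 3) / C ≤ (A (x 0)).toOuterMeasure (Prod.fst ⁻¹' {i}) := by
      refine ENNReal.div_le_of_le_mul' ?_
      calc ENNReal.ofReal (2 / 3)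
          ≤ (A (x i)).toOuterMeasure (Prod.fst ⁻¹' {i} \ Set.range (x i)) := by
            refine hgood i (x i) (fun j k hjk => Fin.ext (Prod.ext_iff.1 hjk).2) ?_
            rintro _ ⟨j, rfl⟩
            rfl
        _ ≤ (A (x i)).toOuterMeasure (Prod.fst ⁻¹' {i}) :=
            MeasureTheory.measure_mono Set.sdiff_subset
        _ ≤ C * (A (x 0)).toOuterMeasure (Prod.fst ⁻¹' {i}) := by
            simpa [hC] using hA.le_pow_mul hε.le (Prod.fst ⁻¹' {i}) Finset.univ (x i) (x 0)
              (by simp)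
    have hzero := (A (x 0)).eq_zero_of_le_toOuterMeasure_fst_preimage _ hmass
    rw [ENNReal.div_eq_zero_iff, ENNReal.ofReal_eq_zero] at hzero
    rcases hzero with h | h
    · norm_num at h
    · exact hCtop h
end

section
/- Let 𝓛 = {L_i}_{i∈ℕ} be a countable collection of infinite subsets of ℕ. Then the following are equivalent: (i) for every ε > 0 there exists a prefix-causal, ε-differentially private (in the continual release model) identification algorithm that identifies 𝓛 in the limit from stochastic inputs; (ii) 𝓛 satisfies Angluin's condition. -/
open MeasureTheory

/-- Angluin's condition: every language has a finite tell-tale. -/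
def AngluinCondition (L : ℕ → Set ℕ) : Prop :=
  ∀ i : ℕ, ∃ T : Finset ℕ, ↑T ⊆ L i ∧ ∀ j : ℕ, ↑T ⊆ L j → ¬ (L j ⊂ L i)

/-- `μ` is the law of an i.i.d. stream with marginal `D`, i.e. the infinite
product measure `D^⊗ℕ`: it is a probability measure whose value on every
cylinder set is the corresponding product of `D`-probabilities (this
characterizes `D^⊗ℕ` uniquely on the product σ-algebra). -/
def IsIIDStream (D : PMF ℕ) (μ : Measure (ℕ → ℕ)) : Prop :=
  IsProbabilityMeasure μ ∧
    ∀ (n : ℕ) (y : Fin n → ℕ),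
      μ {x | ∀ m : Fin n, x m.val = y m} = ∏ m : Fin n, D (y m)

/-- `A` identifies the collection `L` in the limit from stochastic inputs:
for every target index `i` and every distribution `D` supported exactly on
`L i`, on an i.i.d. input stream from `D` the output indices are, with overall
probability 1, eventually always correct. -/
def IdentifiesStochastically (L : ℕ → Set ℕ) (A : (ℕ → ℕ) → Measure (ℕ → ℕ)) :
    Prop :=
  ∀ (i : ℕ) (D : PMF ℕ), D.support = L i →
    ∀ μ : Measure (ℕ → ℕ), IsIIDStream D μ →
      ∫⁻ x, A x {w | ∃ N : ℕ, ∀ n ≥ N, L (w n) = L i} ∂μ = 1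

open Filter Topology ENNReal

/-- The law of an i.i.d. stream is determined by its marginal. -/
theorem IsIIDStream.eq_infinitePi {D : PMF ℕ} {μ : Measure (ℕ → ℕ)} (h : IsIIDStream D μ)
    (h' : IsIIDStream D (Measure.infinitePi fun _ : ℕ => D.toMeasure)) :
    μ = Measure.infinitePi fun _ : ℕ => D.toMeasure := by
  have := h.1
  refine Measure.eq_infinitePi _ fun s t ht => ?_
  obtain ⟨n, hn⟩ : ∃ n, s ⊆ Finset.range n := s.exists_nat_subset_range
  set π := Measure.infinitePi fun _ : ℕ => D.toMeasure with hπ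
  have hr : Measurable fun (x : ℕ → ℕ) (m : Fin n) => x m.val := by fun_prop
  have key : μ.map (fun (x : ℕ → ℕ) (m : Fin n) => x m.val)
      = π.map (fun (x : ℕ → ℕ) (m : Fin n) => x m.val) := by
    refine Measure.ext_of_singleton fun y => ?_
    rw [Measure.map_apply hr (measurableSet_singleton _),
      Measure.map_apply hr (measurableSet_singleton _)]
    have e : (fun (x : ℕ → ℕ) (m : Fin n) => x m.val) ⁻¹' {y} = {x | ∀ m : Fin n, x m.val = y m} := by
      ext x; simp [funext_iff]
    rw [e, h.2, h'.2]
  have e : (s : Set ℕ).pi t = (fun (x : ℕ → ℕ) (m : Fin n) => x m.val) ⁻¹'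
      {y | ∀ m : Fin n, m.val ∈ s → y m ∈ t m.val} := by
    ext x
    simp only [Set.mem_pi, Finset.mem_coe, Set.mem_preimage, Set.mem_ofPred_eq]
    exact ⟨fun H m hm => H _ hm, fun H m hm => H ⟨m, by simpa using hn hm⟩ hm⟩
  rw [e, ← Measure.map_apply hr (Set.to_countable _).measurableSet, key,
    Measure.map_apply hr (Set.to_countable _).measurableSet, ← e,
    Measure.infinitePi_pi _ fun i _ => ht i]

theorem isIIDStream_infinitePi (D : PMF ℕ) :
    IsIIDStream D (Measure.infinitePi fun _ : ℕ => D.toMeasure) := by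
  refine ⟨inferInstance, fun n y => ?_⟩
  have e : {x : ℕ → ℕ | ∀ m : Fin n, x m.val = y m}
      = (Finset.range n : Set ℕ).pi (fun m => if h : m < n then {y ⟨m, h⟩} else Set.univ) := by
    ext x
    simp only [Set.mem_ofPred_eq, Set.mem_pi, Finset.coe_range, Set.mem_Iio]
    constructor
    · intro H m hm
      simp [hm, H ⟨m, hm⟩]
    · intro H m
      simpa using H m m.2
  rw [e, Measure.infinitePi_pi _ fun _ _ => (Set.to_countable _).measurableSet,
    Finset.prod_range]
  refine Finset.prod_congr rfl fun m _ => ?_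
  simp [PMF.toMeasure_apply_singleton]

theorem isIIDStream_map (p : PMF ℕ) (t : ℕ → ℕ) :
    IsIIDStream (p.map t)
      ((Measure.infinitePi fun _ : ℕ => p.toMeasure).map fun g n => t (g n)) := by
  rw [Measure.infinitePi_map_pi (f := fun _ => t) _ fun _ => measurable_from_top]
  have e : p.toMeasure.map t = (p.map t).toMeasure := (PMF.toMeasure_map t p measurable_from_top)
  simp only [e]
  exact isIIDStream_infinitePi _

/-- A function of a stream of letters that only depends on finitely many of them is continuous. -/
theorem continuous_of_depends_prefix {K β : Type*} [TopologicalSpace K] [DiscreteTopology K]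
    [Nonempty K] [TopologicalSpace β] (f : (ℕ → K) → β) (s : Finset ℕ)
    (hf : ∀ x x' : ℕ → K, (∀ m ∈ s, x m = x' m) → f x = f x') : Continuous f := by
  classical
  let k : K := Classical.arbitrary K
  let ext : (s → K) → ℕ → K := fun y m => if h : m ∈ s then y ⟨m, h⟩ else k
  have e : f = (f ∘ ext) ∘ (fun x (m : s) => x m.val) := by
    funext x
    refine hf _ _ fun m hm => ?_
    simp [ext, hm]
  rw [e]
  exact continuous_of_discreteTopology.comp (by fun_prop)

theorem measurable_of_depends_prefix {β : Type*} [MeasurableSpace β] (f : (ℕ → ℕ) → β)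
    (s : Finset ℕ) (hf : ∀ x x' : ℕ → ℕ, (∀ m ∈ s, x m = x' m) → f x = f x') :
    Measurable f := by
  classical
  let ext : (s → ℕ) → ℕ → ℕ := fun y m => if h : m ∈ s then y ⟨m, h⟩ else 0
  have e : f = (f ∘ ext) ∘ (fun x (m : s) => x m.val) := by
    funext x
    refine hf _ _ fun m hm => ?_
    simp [ext, hm]
  rw [e]
  exact (measurable_of_countable _).comp (by fun_prop)

/-- The probability that `A`, run on a random subsequence of the text `t`, outputs
at time `n` an index of `K`. -/
noncomputable def successProb (L : ℕ → Set ℕ) (A : (ℕ → ℕ) → Measure (ℕ → ℕ)) (p : PMF ℕ)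
    (K : Set ℕ) (n : ℕ) (t : ℕ → ℕ) : ℝ :=
  ∫ g, (A fun m => t (g m)).real {w | L (w n) = K} ∂(Measure.infinitePi fun _ : ℕ => p.toMeasure)

theorem measurable_comp_text (t : ℕ → ℕ) : Measurable fun (g : ℕ → ℕ) (n : ℕ) => t (g n) :=
  measurable_pi_lambda _ fun n => measurable_from_top.comp (measurable_pi_apply n)

theorem measurableSet_output (L : ℕ → Set ℕ) (K : Set ℕ) (n : ℕ) :
    MeasurableSet {w : ℕ → ℕ | L (w n) = K} :=
  (MeasurableSet.of_discrete (s := {k : ℕ | L k = K})).preimage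
    (measurable_pi_apply n : Measurable fun w : ℕ → ℕ => w n)

section successProb

variable {L : ℕ → Set ℕ} {A : (ℕ → ℕ) → Measure (ℕ → ℕ)} {p : PMF ℕ}

theorem successProb_eq_bind (hA : Measurable A) (K : Set ℕ) (n : ℕ) (t : ℕ → ℕ)
    [∀ x, IsProbabilityMeasure (A x)] :
    successProb L A p K n t =
      (((Measure.infinitePi fun _ : ℕ => p.toMeasure).map fun g n => t (g n)).bind A).real
        {w | L (w n) = K} := by
  have hS := measurableSet_output L K n
  have hm : Measurable fun x => A x {w | L (w n) = K} := (Measure.measurable_coe hS).comp hA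
  have ht := measurable_comp_text t
  rw [measureReal_def, Measure.bind_apply hS hA.aemeasurable, lintegral_map hm ht, successProb]
  simp only [measureReal_def]
  exact integral_toReal (hm.comp ht).aemeasurable (by simp [measure_lt_top])

theorem continuous_successProb (hA : Measurable A) (hc : PrefixCausal A)
    [∀ x, IsProbabilityMeasure (A x)] (K S : Set ℕ) [Nonempty S] (n : ℕ) :
    Continuous fun t : ℕ → S => successProb L A p K n fun m => (t m).val := by
  have hS := measurableSet_output L K n
  have hm : Measurable fun x => A x {w | L (w n) = K} := (Measure.measurable_coe hS).comp hA
  refine continuous_of_dominated (bound := fun _ => 1) (fun t => ?_) (fun t => ?_)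
    (integrable_const _) (ae_of_all _ fun g => ?_)
  · exact (hm.comp (measurable_comp_text fun m => (t m).val)).ennreal_toReal.aestronglyMeasurable
  · refine ae_of_all _ fun g => ?_
    rw [Real.norm_of_nonneg measureReal_nonneg]
    exact measureReal_le_one
  · refine continuous_of_depends_prefix _ ((Finset.range (n + 1)).image g) fun x x' h => ?_
    have := hc (fun m => (x (g m)).val) (fun m => (x' (g m)).val) (n + 1) fun m hm => by
      rw [h (g m) (Finset.mem_image_of_mem _ (by simpa using hm))]
    have hr : Measurable fun (w : ℕ → ℕ) (m : Fin (n + 1)) => w m.val := by fun_prop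
    have e : {w : ℕ → ℕ | L (w n) = K} = (fun (w : ℕ → ℕ) (m : Fin (n + 1)) => w m.val) ⁻¹'
      {y | L (y (Fin.last n)) = K} := by ext; simp
    simp only [measureReal_def]
    rw [e, ← Measure.map_apply hr (Set.to_countable _).measurableSet, this,
      Measure.map_apply hr (Set.to_countable _).measurableSet]

/-- On a text for `L i` the success probability is eventually large. -/
theorem exists_successProb_gt (hA : Measurable A) (hp : p.support = Set.univ)
    [∀ x, IsProbabilityMeasure (A x)] (hid : IdentifiesStochastically L A) (i : ℕ) (t : ℕ → ℕ)
    (ht : Set.range t = L i) : ∃ N, ∀ n ≥ N, 1 / 2 < successProb L A p (L i) n t := by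
  set μ := (Measure.infinitePi fun _ : ℕ => p.toMeasure).map fun g n => t (g n) with hμ
  have hiid := isIIDStream_map p t
  have := hiid.1
  have h1 := hid i (p.map t) (by rw [PMF.support_map, hp, Set.image_univ, ht]) μ hiid
  have hmeas : ∀ N, MeasurableSet {w : ℕ → ℕ | ∀ n ≥ N, L (w n) = L i} := fun N => by
    simp only [Set.ofPred_forall]
    exact .iInter fun n => .iInter fun _ => measurableSet_output L (L i) n
  have hU : {w : ℕ → ℕ | ∃ N, ∀ n ≥ N, L (w n) = L i}
      = ⋃ N, {w : ℕ → ℕ | ∀ n ≥ N, L (w n) = L i} := by ext; simp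
  rw [← Measure.bind_apply (hU ▸ .iUnion hmeas) hA.aemeasurable, hU] at h1
  have hb : IsProbabilityMeasure (μ.bind A) :=
    isProbabilityMeasure_bind hA.aemeasurable (ae_of_all _ inferInstance)
  have hmono : Monotone fun N => {w : ℕ → ℕ | ∀ n ≥ N, L (w n) = L i} :=
    fun a b hab w hw n hn => hw n (hab.trans hn)
  have htend := tendsto_measure_iUnion_atTop (μ := μ.bind A) hmono
  rw [h1] at htend
  obtain ⟨N, hN⟩ := (htend.eventually (lt_mem_nhds (show (1 / 2 : ℝ≥0∞) < 1 by
    simp))).exists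
  refine ⟨N, fun n hn => ?_⟩
  rw [successProb_eq_bind hA, measureReal_def]
  have : (1 / 2 : ℝ≥0∞) < (μ.bind A) {w | L (w n) = L i} :=
    hN.trans_le (measure_mono fun w hw => hw n hn)
  simpa using (ENNReal.toReal_lt_toReal (by simp) (measure_ne_top _ _)).2 this

theorem successProb_add_le_one (hA : Measurable A) [∀ x, IsProbabilityMeasure (A x)]
    {K K' : Set ℕ} (h : K ≠ K') (n : ℕ) (t : ℕ → ℕ) :
    successProb L A p K n t + successProb L A p K' n t ≤ 1 := by
  have := (isIIDStream_map p t).1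
  have hb : IsProbabilityMeasure
      (((Measure.infinitePi fun _ : ℕ => p.toMeasure).map fun g n => t (g n)).bind A) :=
    isProbabilityMeasure_bind hA.aemeasurable (ae_of_all _ inferInstance)
  rw [successProb_eq_bind hA, successProb_eq_bind hA, ← measureReal_union _
    (measurableSet_output L K' n)]
  · exact measureReal_le_one
  · rw [Set.disjoint_left]
    intro w hw hw'
    exact h (hw.symm.trans hw')

end successProb

/-- The stream that follows `t` for `m` steps and then continues as `e`. -/
def splice {S : Type*} (t e : ℕ → S) (m n : ℕ) : S := if n < m then t n else e (n - m)

theorem tendsto_splice {S : Type*} [TopologicalSpace S] (t : ℕ → S) (e : ℕ → ℕ → S) :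
    Tendsto (fun m => splice t (e m) m) atTop (𝓝 t) := by
  rw [tendsto_pi_nhds]
  intro n
  refine tendsto_const_nhds.congr' ?_
  filter_upwards [eventually_gt_atTop n] with m hm
  simp [splice, hm]

/-- Stochastic identification by a causal randomized algorithm forces finite tell-tales. -/
theorem angluinCondition_of_identifies {L : ℕ → Set ℕ} (hL : ∀ i, (L i).Nonempty)
    {A : (ℕ → ℕ) → Measure (ℕ → ℕ)} (hA : Measurable A) [∀ x, IsProbabilityMeasure (A x)]
    (hc : PrefixCausal A) (hid : IdentifiesStochastically L A) : AngluinCondition L := by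
  intro i
  by_contra! hno
  obtain ⟨p, hp⟩ : ∃ p : PMF ℕ, p.support = Set.univ := by
    refine ⟨PMF.normalize (fun n : ℕ => (2⁻¹ : ℝ≥0∞) ^ n) ?_ ?_, ?_⟩
    · simp [ENNReal.tsum_geometric]
    · simp [ENNReal.tsum_geometric]
    · rw [PMF.support_normalize]
      ext n
      simp
  have : Nonempty (L i) := (hL i).to_subtype
  choose j hj hjs using fun (t : ℕ → L i) (m : ℕ) =>
    hno ((Finset.range m).image fun n => (t n).val) (by
      simp only [Finset.coe_image, Set.image_subset_iff]
      exact fun n _ => (t n).2)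
  have henum : ∀ k, ∃ e : ℕ → ℕ, Set.range e = L k := fun k => by
    obtain ⟨e, he⟩ := (Set.to_countable (L k)).exists_eq_range (hL k)
    exact ⟨e, he.symm⟩
  choose enum henum using henum
  have hmem : ∀ t m n, enum (j t m) n ∈ L i := fun t m n =>
    (hjs t m).1 (henum (j t m) ▸ Set.mem_range_self n)
  let U : ℕ → Set (ℕ → L i) := fun N =>
    {t | ∃ n ≥ N, successProb L A p (L i) n (fun m => (t m).val) < 1 / 2}
  let V : ℕ → Set (ℕ → L i) := fun y => {t | y ∈ L i → ∃ n, (t n).val = y}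
  have hUo : ∀ N, IsOpen (U N) := fun N => by
    simp only [U, ge_iff_le, Set.ofPred_exists, Set.ofPred_and]
    refine isOpen_iUnion fun n => isOpen_const.inter ?_
    exact isOpen_lt (continuous_successProb hA hc _ _ n) continuous_const
  have hUd : ∀ N, Dense (U N) := fun N t => by
    refine mem_closure_of_tendsto (tendsto_splice t fun m n => ⟨enum (j t m) n, hmem t m n⟩)
      (Eventually.of_forall fun m => ?_)
    have hr : Set.range (fun n => (splice t (fun n => (⟨enum (j t m) n, hmem t m n⟩ : L i)) m n).val)
        = L (j t m) := by
      refine Set.Subset.antisymm ?_ fun y hy => ?_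
      · rintro _ ⟨n, rfl⟩
        by_cases h : n < m
        · simp only [splice, h, if_true]
          exact hj t m (by simpa using ⟨n, h, rfl⟩)
        · simp only [splice, h, if_false]
          exact henum (j t m) ▸ Set.mem_range_self _
      · rw [← henum] at hy
        obtain ⟨n, rfl⟩ := hy
        exact ⟨n + m, by simp [splice]⟩
    obtain ⟨N', hN'⟩ := exists_successProb_gt hA hp hid _ _ hr
    refine ⟨max N N', le_max_left _ _, ?_⟩
    have h1 := hN' (max N N') (le_max_right _ _)
    have h2 := successProb_add_le_one (L := L) (p := p) hA (hjs t m).ne (max N N')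
      (fun n => (splice t (fun n => (⟨enum (j t m) n, hmem t m n⟩ : L i)) m n).val)
    linarith
  have hVo : ∀ y, IsOpen (V y) := fun y => by
    by_cases hy : y ∈ L i
    · simp only [V, hy, true_imp_iff, Set.ofPred_exists]
      exact isOpen_iUnion fun n =>
        (isOpen_discrete {s : L i | s.val = y}).preimage
          (continuous_apply n : Continuous fun t : ℕ → L i => t n)
    · simp [V, hy]
  have hVd : ∀ y, Dense (V y) := fun y t => by
    by_cases hy : y ∈ L i
    · refine mem_closure_of_tendsto (tendsto_splice t fun _ _ => ⟨y, hy⟩)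
        (Eventually.of_forall fun m _ => ⟨m, by simp [splice]⟩)
    · exact subset_closure fun h => absurd h hy
  obtain ⟨t, ht⟩ := (dense_iInter_of_isOpen_nat (fun n => (hUo n).inter (hVo n))
    fun n => (hUd n).inter_of_isOpen_left (hVd n) (hUo n)).nonempty
  simp only [Set.mem_iInter, Set.mem_inter_iff] at ht
  have hr : Set.range (fun n => (t n).val) = L i := by
    refine Set.Subset.antisymm ?_ fun y hy => (ht y).2 hy
    rintro _ ⟨n, rfl⟩
    exact (t n).2
  obtain ⟨N, hN⟩ := exists_successProb_gt hA hp hid _ _ hr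
  obtain ⟨n, hn, hlt⟩ := (ht N).1
  exact lt_asymm (hN n hn) hlt

/-! ### Products of measures differing in one factor -/

theorem measurable_update_prod (k₀ : ℕ) :
    Measurable fun q : ℕ × (ℕ → ℕ) => Function.update q.2 k₀ q.1 := by
  refine measurable_pi_lambda _ fun k => ?_
  by_cases hk : k = k₀
  · subst hk; simpa using measurable_fst
  · simp only [Function.update_of_ne hk]
    exact (measurable_pi_apply k).comp measurable_snd

theorem infinitePi_eq_map_update {μ ν : ℕ → Measure ℕ} [∀ k, IsProbabilityMeasure (μ k)]
    [∀ k, IsProbabilityMeasure (ν k)] (k₀ : ℕ) (h : ∀ k, k ≠ k₀ → μ k = ν k) :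
    Measure.infinitePi μ = ((μ k₀).prod (Measure.infinitePi ν)).map
      fun q : ℕ × (ℕ → ℕ) => Function.update q.2 k₀ q.1 := by
  refine (Measure.eq_infinitePi _ fun s t ht => ?_).symm
  rw [Measure.map_apply (measurable_update_prod k₀) (.pi s.countable_toSet fun k _ => ht k)]
  have e : (fun q : ℕ × (ℕ → ℕ) => Function.update q.2 k₀ q.1) ⁻¹' (s : Set ℕ).pi t
      = (if k₀ ∈ s then t k₀ else Set.univ) ×ˢ ((s.erase k₀ : Finset ℕ) : Set ℕ).pi t := by
    ext ⟨a, z⟩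
    simp only [Set.mem_preimage, Set.mem_pi, Finset.mem_coe, Set.mem_prod, Finset.mem_erase]
    constructor
    · intro H
      refine ⟨?_, fun k hk => by simpa [Function.update_of_ne hk.1] using H k hk.2⟩
      split_ifs with hk
      · simpa using H k₀ hk
      · trivial
    · rintro ⟨H1, H2⟩ k hk
      by_cases hkk : k = k₀
      · subst hkk; simpa [hk] using H1
      · simpa [Function.update_of_ne hkk] using H2 k ⟨hkk, hk⟩
  rw [e, Measure.prod_prod, Measure.infinitePi_pi _ fun k _ => ht k]
  have e' : ∏ k ∈ s.erase k₀, ν k (t k) = ∏ k ∈ s.erase k₀, μ k (t k) :=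
    Finset.prod_congr rfl fun k hk => by rw [h k (Finset.ne_of_mem_erase hk)]
  rw [e']
  split_ifs with hk
  · exact Finset.mul_prod_erase s (fun k => μ k (t k)) hk
  · simp [Finset.erase_eq_of_notMem hk]

theorem infinitePi_le_smul {μ ν : ℕ → Measure ℕ} [∀ k, IsProbabilityMeasure (μ k)]
    [∀ k, IsProbabilityMeasure (ν k)] (k₀ : ℕ) (h : ∀ k, k ≠ k₀ → μ k = ν k) {c : ℝ≥0∞}
    (hc : μ k₀ ≤ c • ν k₀) : Measure.infinitePi μ ≤ c • Measure.infinitePi ν := by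
  have hprod : (μ k₀).prod (Measure.infinitePi ν) ≤ c • (ν k₀).prod (Measure.infinitePi ν) := by
    refine Measure.le_intro fun E hE _ => ?_
    rw [Measure.smul_apply, Measure.prod_apply hE, Measure.prod_apply hE,
      ← lintegral_smul_measure]
    exact lintegral_mono' hc le_rfl
  have hmap := Measure.map_mono hprod (measurable_update_prod k₀)
  rwa [Measure.map_smul, ← infinitePi_eq_map_update k₀ h,
    ← infinitePi_eq_map_update k₀ fun _ _ => rfl] at hmap

/-! ### The exponential mechanism with a geometric prior -/

/-- The unnormalized weight of index `j` when its score is `v j`. -/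
noncomputable def expWeight (q r : ℝ≥0∞) (v : ℕ → ℕ) (j : ℕ) : ℝ≥0∞ := q ^ v j * r ^ j

theorem tsum_expWeight_ne_zero {q : ℝ≥0∞} {r : ℝ≥0∞} (hq : 1 ≤ q) (v : ℕ → ℕ) :
    ∑' j, expWeight q r v j ≠ 0 := by
  intro h
  have := ENNReal.tsum_eq_zero.1 h 0
  simp only [expWeight, pow_zero, mul_one] at this
  exact absurd this (pow_ne_zero _ (one_pos.trans_le hq).ne')

theorem tsum_expWeight_ne_top {q r : ℝ≥0∞} (hq : 1 ≤ q) (hq' : q ≠ ∞) (hr : r < 1) {v : ℕ → ℕ}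
    {M : ℕ} (hv : ∀ j, v j ≤ M) : ∑' j, expWeight q r v j ≠ ∞ := by
  refine ne_top_of_le_ne_top ?_
    (ENNReal.tsum_le_tsum (g := fun j => q ^ M * r ^ j) fun j => ?_)
  · rw [ENNReal.tsum_mul_left, ENNReal.tsum_geometric]
    refine ENNReal.mul_ne_top (ENNReal.pow_ne_top hq') (ENNReal.inv_ne_top.2 ?_)
    exact (tsub_pos_of_lt hr).ne'
  · exact mul_le_mul_left (pow_le_pow_right₀ hq (hv j)) _

theorem expWeight_le {q r : ℝ≥0∞} (hq : 1 ≤ q) {v v' : ℕ → ℕ} {j : ℕ} (h : v j ≤ v' j + 1) :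
    expWeight q r v j ≤ q * expWeight q r v' j := by
  rw [expWeight, expWeight, ← mul_assoc, ← pow_succ']
  exact mul_le_mul_left (pow_le_pow_right₀ hq h) _

theorem expWeight_div_le {q r : ℝ≥0∞} (hq : 1 ≤ q) (hq' : q ≠ ∞) {v v' : ℕ → ℕ}
    (h : ∀ j, v j ≤ v' j + 1) (h' : ∀ j, v' j ≤ v j + 1) (j : ℕ) :
    expWeight q r v j * (∑' i, expWeight q r v i)⁻¹ ≤
      q ^ 2 * (expWeight q r v' j * (∑' i, expWeight q r v' i)⁻¹) := by
  have hq0 : q ≠ 0 := (one_pos.trans_le hq).ne'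
  have hZ : ∑' i, expWeight q r v' i ≤ q * ∑' i, expWeight q r v i := by
    rw [← ENNReal.tsum_mul_left]
    exact ENNReal.tsum_le_tsum fun i => expWeight_le hq (h' i)
  have hZ' : (∑' i, expWeight q r v i)⁻¹ ≤ q * (∑' i, expWeight q r v' i)⁻¹ := by
    calc (∑' i, expWeight q r v i)⁻¹ = q * (q * ∑' i, expWeight q r v i)⁻¹ := by
          rw [ENNReal.mul_inv (.inl hq0) (.inl hq'), ← mul_assoc, ENNReal.mul_inv_cancel hq0 hq',
            one_mul]
      _ ≤ _ := by gcongr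
  calc _ ≤ (q * expWeight q r v' j) * (q * (∑' i, expWeight q r v' i)⁻¹) :=
        mul_le_mul' (expWeight_le hq (h j)) hZ'
    _ = _ := by ring

theorem expWeight_tail_le {q r : ℝ≥0∞} (hq : 1 ≤ q) (hq' : q ≠ ∞) (hr0 : r ≠ 0)
    (hr : r ≤ 2⁻¹) {v : ℕ → ℕ} {i M : ℕ} (hi : v i = M) (hv : ∀ j, v j ≤ M)
    (hlt : ∀ j < i, v j = 0) (hM : (r⁻¹) ^ (i + 1) ≤ q ^ M) :
    ∑' j, ({i}ᶜ : Set ℕ).indicator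
      (fun j => expWeight q r v j * (∑' i, expWeight q r v i)⁻¹) j ≤ (i + 3) * r := by
  have hrt : r ≠ ∞ := ne_top_of_le_ne_top (by simp) hr
  have hr1 : r ≤ 1 := hr.trans (by simp)
  have hqM0 : q ^ M ≠ 0 := pow_ne_zero _ (one_pos.trans_le hq).ne'
  have hqMt : q ^ M ≠ ∞ := ENNReal.pow_ne_top hq'
  have hri0 : r ^ i ≠ 0 := pow_ne_zero _ hr0
  have hrit : r ^ i ≠ ∞ := ENNReal.pow_ne_top hrt
  have hZ : (∑' i, expWeight q r v i)⁻¹ ≤ (q ^ M * r ^ i)⁻¹ := by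
    rw [ENNReal.inv_le_inv]
    simpa [expWeight, hi] using ENNReal.le_tsum (f := expWeight q r v) i
  have hlow : ∀ j < i, expWeight q r v j * (∑' i, expWeight q r v i)⁻¹ ≤ r := by
    intro j hj
    have h1 : expWeight q r v j ≤ 1 := by
      simpa [expWeight, hlt j hj] using pow_le_one₀ (n := j) zero_le hr1
    have h2 : (q ^ M * r ^ i)⁻¹ ≤ r := by
      rw [ENNReal.inv_le_iff_inv_le]
      calc r⁻¹ = r⁻¹ ^ (i + 1) * r ^ i := by
            rw [pow_succ', mul_assoc, ← mul_pow, ENNReal.inv_mul_cancel hr0 hrt, one_pow, mul_one]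
        _ ≤ _ := by gcongr
    calc _ ≤ 1 * r := mul_le_mul' h1 (hZ.trans h2)
      _ = r := one_mul r
  have hhigh : ∀ d, expWeight q r v (d + (i + 1)) * (∑' i, expWeight q r v i)⁻¹ ≤ r * r ^ d := by
    intro d
    have h1 : expWeight q r v (d + (i + 1)) ≤ (q ^ M * r ^ i) * (r * r ^ d) := by
      calc _ ≤ q ^ M * r ^ (d + (i + 1)) := mul_le_mul_left (pow_le_pow_right₀ hq (hv _)) _
        _ = _ := by ring
    calc _ ≤ (q ^ M * r ^ i) * (r * r ^ d) * (q ^ M * r ^ i)⁻¹ := mul_le_mul' h1 hZ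
      _ = (q ^ M * r ^ i) * (q ^ M * r ^ i)⁻¹ * (r * r ^ d) := by ring
      _ = _ := by
        rw [ENNReal.mul_inv_cancel (mul_ne_zero hqM0 hri0) (ENNReal.mul_ne_top hqMt hrit), one_mul]
  rw [← ENNReal.summable.sum_add_tsum_nat_add' (k := i + 1)]
  calc _ ≤ ∑ j ∈ Finset.range (i + 1), r + ∑' d, r * r ^ d := by
        refine add_le_add (Finset.sum_le_sum fun j hj => ?_) (ENNReal.tsum_le_tsum fun d => ?_)
        · by_cases hji : j = i
          · simp [hji]
          · rw [Set.indicator_of_mem (by simpa using hji)]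
            exact hlow j (lt_of_le_of_ne (Nat.lt_succ_iff.1 (Finset.mem_range.1 hj)) hji)
        · rw [Set.indicator_of_mem (by simp; omega)]
          exact hhigh d
    _ ≤ (i + 1) * r + r * 2 := by
        rw [ENNReal.tsum_mul_left, ENNReal.tsum_geometric]
        refine add_le_add (by simp) (mul_le_mul_right ?_ _)
        rw [ENNReal.inv_le_iff_inv_le]
        exact (ENNReal.le_sub_of_add_le_left hrt
          ((add_le_add_left hr _).trans_eq ENNReal.inv_two_add_inv_two))
    _ = _ := by ring

/-! ### The private identification algorithm -/

/-- The letters occurring in the `l`-th segment `[l ^ 2, (l + 1) ^ 2)` of the stream `x`. -/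
def segmentLetters (x : ℕ → ℕ) (l : ℕ) : Set ℕ := {y | ∃ n, Nat.sqrt n = l ∧ x n = y}

/-- The segment shows the tell-tale of `L j` and nothing outside of `L j`. -/
def Consistent (L : ℕ → Set ℕ) (T : ℕ → Finset ℕ) (x : ℕ → ℕ) (l j : ℕ) : Prop :=
  ↑(T j) ⊆ segmentLetters x l ∧ segmentLetters x l ⊆ L j

/-- The segments from which the `k`-th choice is made. -/
def block (k : ℕ) : Finset ℕ := Finset.Ico ((k - 1) * (k - 1)) ((k - 1) * (k - 1) + k)

open Classical in
/-- The number of segments in the `k`-th block consistent with index `j`. -/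
noncomputable def score (L : ℕ → Set ℕ) (T : ℕ → Finset ℕ) (k : ℕ) (x : ℕ → ℕ) (j : ℕ) : ℕ :=
  ((block k).filter fun l => Consistent L T x l j).card

theorem card_block (k : ℕ) : (block k).card = k := by simp [block]

theorem sqrt_of_mem_block {k l : ℕ} (h : l ∈ block k) : Nat.sqrt l + 1 = k := by
  rw [block, Finset.mem_Ico] at h
  obtain ⟨a, rfl⟩ := Nat.exists_eq_add_of_le h.1
  rw [Nat.sqrt_add_eq _ (by omega)]
  omega

theorem score_le (L : ℕ → Set ℕ) (T : ℕ → Finset ℕ) (k : ℕ) (x : ℕ → ℕ) (j : ℕ) :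
    score L T k x j ≤ k :=
  by classical exact (Finset.card_filter_le _ _).trans_eq (card_block k)

theorem segmentLetters_congr {x x' : ℕ → ℕ} {l : ℕ} (h : ∀ n, Nat.sqrt n = l → x n = x' n) :
    segmentLetters x l = segmentLetters x' l := by
  ext y
  refine exists_congr fun n => and_congr_right fun hn => ?_
  rw [h n hn]

theorem score_congr {L : ℕ → Set ℕ} {T : ℕ → Finset ℕ} {k : ℕ} {x x' : ℕ → ℕ}
    (h : ∀ n, Nat.sqrt (Nat.sqrt n) + 1 = k → x n = x' n) : score L T k x = score L T k x' := by
  classical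
  funext j
  refine congrArg Finset.card (Finset.filter_congr fun l hl => ?_)
  rw [Consistent, Consistent, segmentLetters_congr fun n hn => h n ?_]
  rw [hn]
  exact sqrt_of_mem_block hl

theorem score_le_add_one (L : ℕ → Set ℕ) (T : ℕ → Finset ℕ) (k : ℕ) {x x' : ℕ → ℕ} {m : ℕ}
    (h : ∀ n, n ≠ m → x n = x' n) (j : ℕ) : score L T k x j ≤ score L T k x' j + 1 := by
  classical
  refine (Finset.card_le_card ?_).trans (Finset.card_insert_le (Nat.sqrt m) _)
  intro l hl
  rw [Finset.mem_filter] at hl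
  by_cases hlm : l = Nat.sqrt m
  · simp [hlm]
  · refine Finset.mem_insert_of_mem (Finset.mem_filter.2 ⟨hl.1, ?_⟩)
    have := hl.2
    rwa [Consistent, segmentLetters_congr (x' := x') fun n hn => h n ?_] at this
    rintro rfl
    exact hlm hn.symm

/-- The base of the geometric prior used for the `k`-th choice. -/
noncomputable def priorBase (k : ℕ) : ℝ≥0∞ := (((k : ℝ≥0∞) + 2) ^ 2)⁻¹

theorem priorBase_ne_zero (k : ℕ) : priorBase k ≠ 0 := by
  simp [priorBase, ENNReal.inv_eq_zero, ENNReal.pow_eq_top_iff]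

theorem priorBase_le (k : ℕ) : priorBase k ≤ 2⁻¹ := by
  rw [priorBase, ENNReal.inv_le_inv]
  have : (2 : ℝ≥0∞) ≤ k + 2 := le_add_self
  exact this.trans (le_self_pow₀ (le_trans (by norm_num) this) two_ne_zero)

theorem priorBase_lt_one (k : ℕ) : priorBase k < 1 :=
  (priorBase_le k).trans_lt (by simp)

theorem tsum_priorBase_ne_top : ∑' k, priorBase k ≠ ∞ := by
  have h : Summable fun k : ℕ => (((k + 2 : ℕ) : NNReal) ^ 2)⁻¹ :=
    (NNReal.summable_nat_add_iff (f := fun k : ℕ => ((k : NNReal) ^ 2)⁻¹) 2).2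
      (by simpa using NNReal.summable_rpow_inv.2 (one_lt_two (α := ℝ)))
  convert ENNReal.tsum_coe_ne_top_iff_summable.2 h using 3 with k
  rw [priorBase, ENNReal.coe_inv (by positivity)]
  push_cast
  rfl

/-- The factor by which a weight grows per unit of score. -/
noncomputable def privacyFactor (ε : ℝ) : ℝ≥0∞ := ENNReal.ofReal (Real.exp (ε / 2))

theorem one_le_privacyFactor {ε : ℝ} (hε : 0 < ε) : 1 ≤ privacyFactor ε := by
  rw [privacyFactor, ENNReal.one_le_ofReal]
  exact Real.one_le_exp (by positivity)

theorem privacyFactor_ne_top (ε : ℝ) : privacyFactor ε ≠ ∞ := ENNReal.ofReal_ne_top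

theorem privacyFactor_sq (ε : ℝ) : privacyFactor ε ^ 2 = ENNReal.ofReal (Real.exp ε) := by
  rw [privacyFactor, ← ENNReal.ofReal_pow (Real.exp_nonneg _), ← Real.exp_nat_mul]
  congr 2
  push_cast
  ring

theorem eventually_priorBase_pow_le {ε : ℝ} (hε : 0 < ε) (i : ℕ) :
    ∀ᶠ k : ℕ in atTop, (priorBase k)⁻¹ ^ i ≤ privacyFactor ε ^ k := by
  set ρ : ℝ := Real.exp (-(ε / 2)) with hρ
  have hρ0 : 0 < ρ := Real.exp_pos _
  have hρ1 : ρ < 1 := Real.exp_lt_one_iff.2 (by linarith)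
  have h := (tendsto_pow_const_mul_const_pow_of_abs_lt_one (2 * i)
    (show |ρ| < 1 by rwa [abs_of_pos hρ0])).comp (tendsto_add_atTop_nat 2)
  filter_upwards [h.eventually (gt_mem_nhds (show 0 < ρ ^ 2 by positivity))] with k hk
  have h1 : ((k + 2 : ℝ)) ^ (2 * i) ≤ Real.exp (ε / 2) ^ k := by
    simp only [Function.comp_apply, pow_add, ← mul_assoc] at hk
    have h2 : ((k + 2 : ℕ) : ℝ) ^ (2 * i) * ρ ^ k < 1 := by
      by_contra! hcon
      nlinarith [pow_pos hρ0 2]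
    have h3 : ρ ^ k * Real.exp (ε / 2) ^ k = 1 := by
      rw [← mul_pow, hρ, ← Real.exp_add]
      simp
    calc ((k + 2 : ℝ)) ^ (2 * i)
        = ((k + 2 : ℕ) : ℝ) ^ (2 * i) * ρ ^ k * Real.exp (ε / 2) ^ k := by
          rw [mul_assoc, h3]; push_cast; ring
      _ ≤ 1 * Real.exp (ε / 2) ^ k := by gcongr
      _ = _ := one_mul _
  rw [priorBase, inv_inv, ← pow_mul, privacyFactor, ← ENNReal.ofReal_pow (Real.exp_nonneg _)]
  refine le_trans (le_of_eq ?_) (ENNReal.ofReal_le_ofReal h1)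
  rw [ENNReal.ofReal_pow (by positivity), ENNReal.ofReal_add (by positivity) (by norm_num)]
  simp

section Mechanism

variable (L : ℕ → Set ℕ) (T : ℕ → Finset ℕ) {ε : ℝ} (hε : 0 < ε)

/-- The distribution of the `k`-th choice of the algorithm. -/
noncomputable def choicePMF (k : ℕ) (x : ℕ → ℕ) : PMF ℕ :=
  PMF.normalize (expWeight (privacyFactor ε) (priorBase k) (score L T k x))
    (tsum_expWeight_ne_zero (one_le_privacyFactor hε) _)
    (tsum_expWeight_ne_top (one_le_privacyFactor hε) (privacyFactor_ne_top ε)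
      (priorBase_lt_one k) (score_le L T k x))

/-- The algorithm: the output at time `n` is the choice number `⌊n ^ (1 / 4)⌋`. -/
noncomputable def privateAlgorithm (x : ℕ → ℕ) : Measure (ℕ → ℕ) :=
  (Measure.infinitePi fun k => (choicePMF L T hε k x).toMeasure).map
    fun z n => z (Nat.sqrt (Nat.sqrt n))

theorem measurable_schedule :
    Measurable fun (z : ℕ → ℕ) (n : ℕ) => z (Nat.sqrt (Nat.sqrt n)) := by fun_prop

instance (x : ℕ → ℕ) : IsProbabilityMeasure (privateAlgorithm L T hε x) :=
  Measure.isProbabilityMeasure_map measurable_schedule.aemeasurable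

theorem choicePMF_congr {k : ℕ} {x x' : ℕ → ℕ}
    (h : ∀ n, Nat.sqrt (Nat.sqrt n) + 1 = k → x n = x' n) :
    choicePMF L T hε k x = choicePMF L T hε k x' := by
  simp only [choicePMF, score_congr h]

theorem measurable_choicePMF (k : ℕ) :
    Measurable fun x => (choicePMF L T hε k x).toMeasure := by
  refine measurable_of_depends_prefix _ (Finset.range (k * k * (k * k))) fun x x' h => ?_
  rw [choicePMF_congr L T hε fun n hn => h n ?_]
  rw [Finset.mem_range, ← Nat.sqrt_lt, ← Nat.sqrt_lt]
  omega

theorem measurable_privateAlgorithm : Measurable (privateAlgorithm L T hε) := by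
  refine (Measure.measurable_map _ measurable_schedule).comp ?_
  refine Measurable.measure_of_isPiSystem_of_isProbabilityMeasure
    (generateFrom_squareCylinders (α := fun _ : ℕ => ℕ)).symm
    (isPiSystem_squareCylinders (fun _ => MeasurableSpace.isPiSystem_measurableSet) (by simp)) ?_
  rintro _ ⟨s, t, ht, rfl⟩
  have ht' : ∀ i, MeasurableSet (t i) := fun i => ht i (Set.mem_univ i)
  simp only [Measure.infinitePi_pi _ fun i _ => ht' i]
  exact Finset.measurable_prod _ fun k _ =>
    (Measure.measurable_coe (ht' k)).comp (measurable_choicePMF L T hε k)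

theorem prefixCausal_privateAlgorithm : PrefixCausal (privateAlgorithm L T hε) := by
  intro x x' n h
  let s : Finset ℕ := (Finset.range n).image fun m => Nat.sqrt (Nat.sqrt m)
  let φ : (s → ℕ) → Fin n → ℕ := fun z m =>
    z ⟨Nat.sqrt (Nat.sqrt m), Finset.mem_image_of_mem _ (by simp)⟩
  have hφ : Measurable φ := by fun_prop
  have hr : Measurable fun (w : ℕ → ℕ) (m : Fin n) => w m.val := by fun_prop
  have key : ∀ y, (privateAlgorithm L T hε y).map (fun w (m : Fin n) => w m.val)
      = (Measure.pi fun k : s => (choicePMF L T hε k y).toMeasure).map φ := fun y => by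
    rw [privateAlgorithm, Measure.map_map hr measurable_schedule,
      ← Measure.infinitePi_map_restrict (fun k => (choicePMF L T hε k y).toMeasure),
      Measure.map_map hφ (Finset.measurable_restrict _)]
    rfl
  rw [key, key]
  congr 2
  funext ⟨k, hk⟩
  obtain ⟨m, hm, rfl⟩ := Finset.mem_image.1 hk
  rw [choicePMF_congr L T hε fun n' hn' => h n' ?_]
  by_contra! hcon
  have : m ≤ n' := (Finset.mem_range.1 hm).le.trans hcon
  have := Nat.sqrt_le_sqrt (Nat.sqrt_le_sqrt this)
  simp only at hn'
  omega

theorem dpcr_privateAlgorithm : DPCR ε (privateAlgorithm L T hε) := by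
  rintro x x' ⟨m, -, hm⟩ E -
  have hm' : ∀ n, n ≠ m → x' n = x n := fun n hn => (hm n hn).symm
  have hle : Measure.infinitePi (fun k => (choicePMF L T hε k x).toMeasure) ≤
      ENNReal.ofReal (Real.exp ε) •
        Measure.infinitePi (fun k => (choicePMF L T hε k x').toMeasure) := by
    refine infinitePi_le_smul (Nat.sqrt (Nat.sqrt m) + 1) (fun k hk => ?_) ?_
    · rw [choicePMF_congr L T hε fun n hn => hm n ?_]
      rintro rfl
      exact hk hn.symm
    · refine Measure.le_intro fun S hS _ => ?_
      rw [Measure.smul_apply, PMF.toMeasure_apply _ hS, PMF.toMeasure_apply _ hS, smul_eq_mul,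
        ← ENNReal.tsum_mul_left]
      refine ENNReal.tsum_le_tsum fun j => ?_
      by_cases hj : j ∈ S
      · rw [Set.indicator_of_mem hj, Set.indicator_of_mem hj, ← privacyFactor_sq]
        exact expWeight_div_le (one_le_privacyFactor hε) (privacyFactor_ne_top ε)
          (score_le_add_one L T _ hm) (score_le_add_one L T _ hm') j
      · simp [hj]
  have := Measure.map_mono hle measurable_schedule
  rw [Measure.map_smul] at this
  exact this E

theorem choicePMF_compl_le {k i : ℕ} {x : ℕ → ℕ} (hi : ∀ l ∈ block k, Consistent L T x l i)
    (hlt : ∀ j < i, ∀ l ∈ block k, ¬ Consistent L T x l j)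
    (hk : (priorBase k)⁻¹ ^ (i + 1) ≤ privacyFactor ε ^ k) :
    (choicePMF L T hε k x).toMeasure {i}ᶜ ≤ (i + 3) * priorBase k := by
  classical
  rw [PMF.toMeasure_apply _ (measurableSet_singleton i).compl]
  refine expWeight_tail_le (one_le_privacyFactor hε) (privacyFactor_ne_top ε)
    (priorBase_ne_zero k) (priorBase_le k) (M := k) ?_ (score_le L T k x) (fun j hj => ?_) hk
  · rw [score, Finset.filter_true_of_mem hi, card_block]
  · rw [score, Finset.filter_false_of_mem (hlt j hj), Finset.card_empty]

theorem tendsto_block {P : ℕ → Prop} (h : ∀ᶠ l in atTop, P l) :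
    ∀ᶠ k in atTop, ∀ l ∈ block k, P l := by
  obtain ⟨l₀, hl₀⟩ := eventually_atTop.1 h
  filter_upwards [eventually_gt_atTop l₀] with k hk l hl
  refine hl₀ l ?_
  rw [block, Finset.mem_Ico] at hl
  have : l₀ ≤ k - 1 := by omega
  nlinarith [Nat.le_mul_self (k - 1)]

/-- If eventually every segment is consistent with `i` and with no smaller index, then
the output is almost surely eventually `i`. -/
theorem ae_eventually_eq_privateAlgorithm {i : ℕ} {x : ℕ → ℕ}
    (h : ∀ᶠ l in atTop, Consistent L T x l i ∧ ∀ j < i, ¬ Consistent L T x l j) :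
    ∀ᵐ w ∂privateAlgorithm L T hε x, ∀ᶠ n in atTop, w n = i := by
  have hsched : Tendsto (fun n => Nat.sqrt (Nat.sqrt n)) atTop atTop := by
    have : Tendsto Nat.sqrt atTop atTop :=
      tendsto_atTop_atTop.2 fun b => ⟨b * b, fun a ha => Nat.le_sqrt.2 ha⟩
    exact this.comp this
  have hmeas : MeasurableSet {w : ℕ → ℕ | ∀ᶠ n in atTop, w n = i} := by
    simp only [eventually_atTop, Set.ofPred_exists, Set.ofPred_forall]
    exact .iUnion fun N => .iInter fun n => .iInter fun _ =>
      (measurableSet_singleton i).preimage (measurable_pi_apply n : Measurable fun w : ℕ → ℕ => w n)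
  rw [privateAlgorithm, ae_map_iff measurable_schedule.aemeasurable hmeas]
  suffices H : ∀ᵐ z ∂Measure.infinitePi fun k => (choicePMF L T hε k x).toMeasure,
      ∀ᶠ k in atTop, z k = i by
    filter_upwards [H] with z hz using hsched.eventually hz
  obtain ⟨k₀, hk₀⟩ := eventually_atTop.1
    ((tendsto_block h).and (eventually_priorBase_pow_le hε (i + 1)))
  have hbc := ae_eventually_notMem
    (μ := Measure.infinitePi fun k => (choicePMF L T hε k x).toMeasure)
    (s := fun d => {z : ℕ → ℕ | z (d + k₀) ∈ ({i}ᶜ : Set ℕ)}) ?_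
  · filter_upwards [hbc] with z hz
    obtain ⟨d₀, hd₀⟩ := eventually_atTop.1 hz
    refine eventually_atTop.2 ⟨d₀ + k₀, fun k hk => ?_⟩
    have := hd₀ (k - k₀) (by omega)
    rw [Nat.sub_add_cancel (by omega)] at this
    simpa using this
  · refine ne_top_of_le_ne_top ?_
      (ENNReal.tsum_le_tsum (g := fun d => (i + 3) * priorBase (d + k₀)) fun d => ?_)
    · rw [ENNReal.tsum_mul_left]
      exact ENNReal.mul_ne_top (by finiteness) (ne_top_of_le_ne_top tsum_priorBase_ne_top
        (ENNReal.tsum_comp_le_tsum_of_injective (add_left_injective k₀) _))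
    · obtain ⟨h1, h2⟩ := hk₀ (d + k₀) (by omega)
      have e : (Measure.infinitePi fun k => (choicePMF L T hε k x).toMeasure)
          {z : ℕ → ℕ | z (d + k₀) ∈ ({i}ᶜ : Set ℕ)}
          = (choicePMF L T hε (d + k₀) x).toMeasure {i}ᶜ := by
        rw [← Measure.infinitePi_map_eval (fun k => (choicePMF L T hε k x).toMeasure) (d + k₀),
          Measure.map_apply (by fun_prop) (measurableSet_singleton i).compl]
        rfl
      rw [e]
      exact choicePMF_compl_le L T hε (fun l hl => (h1 l hl).1)
        (fun j hj l hl => (h1 l hl).2 j hj) h2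

end Mechanism

/-! ### Segments of an i.i.d. stream -/

theorem ae_mem_support {D : PMF ℕ} :
    ∀ᵐ x ∂Measure.infinitePi fun _ : ℕ => D.toMeasure, ∀ n, x n ∈ D.support := by
  refine ae_all_iff.2 fun n => ?_
  have h : ∀ᵐ y ∂D.toMeasure, y ∈ D.support := by
    rw [ae_iff, PMF.toMeasure_apply_eq_zero_iff _ (Set.to_countable _).measurableSet,
      Set.disjoint_left]
    exact fun y hy hy' => hy' hy
  rw [← Measure.infinitePi_map_eval (fun _ : ℕ => D.toMeasure) n] at h
  exact ae_of_ae_map (measurable_pi_apply n).aemeasurable h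

theorem ae_eventually_mem_segmentLetters {D : PMF ℕ} {y : ℕ} (hy : y ∈ D.support) :
    ∀ᵐ x ∂Measure.infinitePi fun _ : ℕ => D.toMeasure,
      ∀ᶠ l in atTop, y ∈ segmentLetters x l := by
  have hbc := ae_eventually_notMem (μ := Measure.infinitePi fun _ : ℕ => D.toMeasure)
    (s := fun l => (Finset.Ico (l * l) (l * l + l) : Set ℕ).pi fun _ => ({y}ᶜ : Set ℕ)) ?_
  · filter_upwards [hbc] with x hx
    filter_upwards [hx] with l hl
    simp only [Set.mem_pi, Finset.mem_coe, Finset.mem_Ico, Set.mem_compl_iff,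
      Set.mem_singleton_iff, not_forall, not_not] at hl
    obtain ⟨n, hn, rfl⟩ := hl
    refine ⟨n, ?_, rfl⟩
    obtain ⟨a, rfl⟩ := Nat.exists_eq_add_of_le hn.1
    exact Nat.sqrt_add_eq _ (by omega)
  · have h1 : D.toMeasure {y}ᶜ < 1 := by
      rw [prob_compl_eq_one_sub (measurableSet_singleton y),
        PMF.toMeasure_apply_singleton _ _ (measurableSet_singleton y)]
      exact ENNReal.sub_lt_self (by simp) (by simp) ((D.mem_support_iff y).1 hy)
    have e : ∀ l : ℕ, (Measure.infinitePi fun _ : ℕ => D.toMeasure)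
        ((Finset.Ico (l * l) (l * l + l) : Set ℕ).pi fun _ => ({y}ᶜ : Set ℕ))
        = D.toMeasure {y}ᶜ ^ l := fun l => by
      rw [Measure.infinitePi_pi _ fun _ _ => (measurableSet_singleton y).compl]
      simp
    simp only [e, ENNReal.tsum_geometric]
    exact ENNReal.inv_ne_top.2 (tsub_pos_of_lt h1).ne'

theorem exists_eventually_consistent {L : ℕ → Set ℕ} {T : ℕ → Finset ℕ}
    (hT : ∀ i, ↑(T i) ⊆ L i ∧ ∀ j, ↑(T i) ⊆ L j → ¬ L j ⊂ L i) (i : ℕ) {x : ℕ → ℕ}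
    (hx : ∀ n, x n ∈ L i) (hx' : ∀ y ∈ L i, ∀ᶠ l in atTop, y ∈ segmentLetters x l) :
    ∃ i₀, L i₀ = L i ∧
      ∀ᶠ l in atTop, Consistent L T x l i₀ ∧ ∀ j < i₀, ¬ Consistent L T x l j := by
  classical
  have hex : ∃ j, L j = L i := ⟨i, rfl⟩
  have hi₀ := Nat.find_spec hex
  refine ⟨Nat.find hex, hi₀, ?_⟩
  have hsub : ∀ l, segmentLetters x l ⊆ L i := by
    rintro l _ ⟨n, -, rfl⟩
    exact hx n
  refine .and ?_ ((Set.finite_lt_nat (Nat.find hex)).eventually_all.2 fun j hj => ?_)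
  · have h1 : ∀ᶠ l in atTop, ∀ y ∈ T (Nat.find hex), y ∈ segmentLetters x l :=
      (Finset.eventually_all _).2 fun y hy => hx' y (hi₀ ▸ (hT _).1 hy)
    filter_upwards [h1] with l hl using ⟨hl, (hsub l).trans hi₀.ge⟩
  · have hne : L j ≠ L i := Nat.find_min hex hj
    by_cases hTj : ↑(T j) ⊆ L i
    · obtain ⟨y, hyi, hyj⟩ : ∃ y ∈ L i, y ∉ L j := by
        by_contra! hcon
        exact (hT j).2 i hTj (LE.le.ssubset_of_ne hcon hne.symm)
      filter_upwards [hx' y hyi] with l hl hcons using hyj (hcons.2 hl)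
    · exact .of_forall fun l hcons => hTj (hcons.1.trans (hsub l))

theorem identifies_privateAlgorithm {L : ℕ → Set ℕ} {T : ℕ → Finset ℕ}
    (hT : ∀ i, ↑(T i) ⊆ L i ∧ ∀ j, ↑(T i) ⊆ L j → ¬ L j ⊂ L i) {ε : ℝ} (hε : 0 < ε) :
    IdentifiesStochastically L (privateAlgorithm L T hε) := by
  intro i D hD μ hμ
  have hprob := hμ.1
  rw [hμ.eq_infinitePi (isIIDStream_infinitePi D)]
  have h1 : ∀ᵐ x ∂Measure.infinitePi fun _ : ℕ => D.toMeasure,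
      privateAlgorithm L T hε x {w | ∃ N : ℕ, ∀ n ≥ N, L (w n) = L i} = 1 := by
    have h2 : ∀ᵐ x ∂Measure.infinitePi fun _ : ℕ => D.toMeasure,
        ∀ y : L i, ∀ᶠ l in atTop, y.val ∈ segmentLetters x l :=
      ae_all_iff.2 fun y => ae_eventually_mem_segmentLetters (by rw [hD]; exact y.2)
    filter_upwards [h2, ae_mem_support] with x hx hx'
    obtain ⟨i₀, hi₀, hcons⟩ := exists_eventually_consistent hT i (fun n => hD ▸ hx' n)
      fun y hy => hx ⟨y, hy⟩
    rw [← measure_univ (μ := privateAlgorithm L T hε x)]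
    refine measure_congr (eventuallyEq_univ.2 ?_)
    filter_upwards [ae_eventually_eq_privateAlgorithm L T hε hcons] with w hw
    obtain ⟨N, hN⟩ := eventually_atTop.1 hw
    exact ⟨N, fun n hn => by rw [hN n hn, hi₀]⟩
  rw [lintegral_congr_ae h1]
  simp

/-- A countable collection of infinite languages is privately
identifiable in the limit from stochastic inputs (for every ε > 0, by a
prefix-causal ε-DP continual-release algorithm) if and only if it satisfies
Angluin's condition. -/
theorem stmt13 (L : ℕ → Set ℕ) (hL : ∀ i, (L i).Infinite) :
    (∀ ε : ℝ, 0 < ε →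
      ∃ A : (ℕ → ℕ) → Measure (ℕ → ℕ),
        (∀ x, IsProbabilityMeasure (A x)) ∧
        (∀ E : Set (ℕ → ℕ), MeasurableSet E → Measurable fun x => A x E) ∧
        PrefixCausal A ∧ DPCR ε A ∧ IdentifiesStochastically L A) ↔
      AngluinCondition L := by
  constructor
  · intro h
    obtain ⟨A, hprob, hmeas, hcausal, -, hid⟩ := h 1 one_pos
    exact angluinCondition_of_identifies (fun i => (hL i).nonempty)
      (Measure.measurable_of_measurable_coe _ hmeas) hcausal hid
  · intro h ε hε
    choose T hT using h
    exact ⟨privateAlgorithm L T hε, inferInstance,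
      fun E hE => (Measure.measurable_coe hE).comp (measurable_privateAlgorithm L T hε),
      prefixCausal_privateAlgorithm L T hε, dpcr_privateAlgorithm L T hε,
      identifies_privateAlgorithm hT hε⟩
end
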